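/- arXiv:2001.06820 — 5 statements merged into one kernel-verified Lean document; each statement's English description precedes it below -/
import Mathlib

section
/- Let a > −1, b > −1 and c > max{0, a−b} be real numbers. Then for every nonnegative integer k, ∫_0^∞ x^k W(x; a, b, c) dx = (a+1)_k (b+1)_k / (c+b+1)_k. In particular (k = 0), W(·; a, b, c) is a probability density on (0, ∞). -/
open MeasureTheory Filter Set

/-- Pochhammer symbol `(z)_k = z (z+1) ⋯ (z+k-1)`. -/
noncomputable def poch (z : ℝ) (k : ℕ) : ℝ := ∏ i ∈ Finset.range k, (z + i)

/-- Confluent hypergeometric function of the second kind (Tricomi function),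
via its integral representation, valid for `α > 0`, `x > 0`. -/
noncomputable def TricomiU (α β x : ℝ) : ℝ :=
  (1 / Real.Gamma α) *
    ∫ t in Set.Ioi (0:ℝ), t ^ (α - 1) * (1 + t) ^ (β - α - 1) * Real.exp (-t * x)

/-- The weight function `W(x; a, b, c)`. -/
noncomputable def W (a b c x : ℝ) : ℝ :=
  (Real.Gamma (c + b + 1) / (Real.Gamma (a + 1) * Real.Gamma (b + 1))) *
    Real.exp (-x) * x ^ a * TricomiU c (a - b + 1) x

lemma aux_gamma (p r : ℝ) (hp : 0 < p) (hr : 0 < r) :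
    ∫⁻ x in Ioi (0:ℝ), ENNReal.ofReal (x ^ (p - 1) * Real.exp (-(r * x)))
      = ENNReal.ofReal (r ^ (-p) * Real.Gamma p) := by
  have h1 := Real.integral_rpow_mul_exp_neg_mul_Ioi hp hr
  have hi : IntegrableOn (fun x : ℝ => x ^ (p - 1) * Real.exp (-(r * x))) (Ioi 0) := by
    apply not_imp_comm.1 integral_undef
    rw [h1]
    have := Real.Gamma_pos_of_pos hp
    positivity
  rw [← ofReal_integral_eq_lintegral_ofReal hi, h1]
  · rw [one_div, Real.inv_rpow hr.le, Real.rpow_neg hr.le]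
  · filter_upwards [ae_restrict_mem measurableSet_Ioi] with x hx
    have : 0 < x := hx
    simp only [Pi.zero_apply]
    positivity

/-- Euler's second form of the Beta integral. -/
lemma aux_beta (u v : ℝ) (hu : 0 < u) (hv : 0 < v) :
    ∫⁻ t in Ioi (0:ℝ), ENNReal.ofReal (t ^ (u - 1) * (1 + t) ^ (-(u + v)))
      = ENNReal.ofReal (Real.Gamma u * Real.Gamma v / Real.Gamma (u + v)) := by
  have hs : 0 < u + v := by positivity
  have gs := Real.Gamma_pos_of_pos hs
  have gu := Real.Gamma_pos_of_pos hu
  have gv := Real.Gamma_pos_of_pos hv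
  have key : ∫⁻ t in Ioi (0:ℝ), ∫⁻ x in Ioi (0:ℝ),
      ENNReal.ofReal (t ^ (u - 1) * (x ^ (u + v - 1) * Real.exp (-((1 + t) * x))))
      = ∫⁻ x in Ioi (0:ℝ), ∫⁻ t in Ioi (0:ℝ),
      ENNReal.ofReal (t ^ (u - 1) * (x ^ (u + v - 1) * Real.exp (-((1 + t) * x)))) := by
    apply lintegral_lintegral_swap
    apply Measurable.aemeasurable
    unfold Function.uncurry
    fun_prop
  have hL : ∫⁻ t in Ioi (0:ℝ), ∫⁻ x in Ioi (0:ℝ),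
      ENNReal.ofReal (t ^ (u - 1) * (x ^ (u + v - 1) * Real.exp (-((1 + t) * x))))
      = (∫⁻ t in Ioi (0:ℝ), ENNReal.ofReal (t ^ (u - 1) * (1 + t) ^ (-(u + v))))
        * ENNReal.ofReal (Real.Gamma (u + v)) := by
    rw [← lintegral_mul_const _ (by fun_prop)]
    apply setLIntegral_congr_fun measurableSet_Ioi
    intro t ht
    have ht : 0 < t := ht
    have h0 : 0 ≤ t ^ (u - 1) := by positivity
    have h1 : 0 ≤ t ^ (u - 1) * (1 + t) ^ (-(u + v)) := by positivity
    simp only [ENNReal.ofReal_mul h0]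
    rw [lintegral_const_mul _ (by fun_prop), aux_gamma _ _ hs (by positivity),
      ENNReal.ofReal_mul (by positivity), mul_assoc]
  have hR : ∫⁻ x in Ioi (0:ℝ), ∫⁻ t in Ioi (0:ℝ),
      ENNReal.ofReal (t ^ (u - 1) * (x ^ (u + v - 1) * Real.exp (-((1 + t) * x))))
      = ENNReal.ofReal (Real.Gamma u * Real.Gamma v) := by
    have : ENNReal.ofReal (Real.Gamma u * Real.Gamma v) = ENNReal.ofReal (Real.Gamma u) *
      ∫⁻ x in Ioi (0:ℝ), ENNReal.ofReal (x ^ (v - 1) * Real.exp (-(1 * x))) := by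
      rw [aux_gamma _ _ hv one_pos, ENNReal.ofReal_mul gu.le]; simp
    rw [this, ← lintegral_const_mul _ (by fun_prop)]
    apply setLIntegral_congr_fun measurableSet_Ioi
    intro x hx
    have hx : 0 < x := hx
    have e : ∀ t : ℝ, t ^ (u - 1) * (x ^ (u + v - 1) * Real.exp (-((1 + t) * x)))
        = (x ^ (u + v - 1) * Real.exp (-x)) * (t ^ (u - 1) * Real.exp (-(x * t))) := by
      intro t
      rw [show -((1 + t) * x) = -x + -(x * t) by ring, Real.exp_add]; ring
    have h0 : 0 ≤ x ^ (u + v - 1) * Real.exp (-x) := by positivity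
    simp only [e, ENNReal.ofReal_mul h0]
    rw [lintegral_const_mul _ (by fun_prop), aux_gamma _ _ hu hx, ← ENNReal.ofReal_mul h0,
      ← ENNReal.ofReal_mul gu.le]
    congr 1
    rw [show v - 1 = (u + v - 1) + (-u) by ring, Real.rpow_add hx, one_mul]; ring
  rw [hL, hR] at key
  rw [ENNReal.ofReal_div_of_pos gs, ← key, ENNReal.mul_div_cancel_right _ ENNReal.ofReal_ne_top]
  simpa using gs

lemma aux_poch (z : ℝ) (hz : 0 < z) (k : ℕ) :
    Real.Gamma (z + k) = poch z k * Real.Gamma z := by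
  induction k with
  | zero => simp [poch]
  | succ n ih =>
    have : z + n ≠ 0 := by positivity
    rw [Nat.cast_succ, ← add_assoc, Real.Gamma_add_one this, ih, poch, poch,
      Finset.prod_range_succ]
    ring

lemma aux_double (p c d : ℝ) (hp : 0 < p) (hc : 0 < c) (hd : 0 < p - d - c) :
    IntegrableOn (fun x : ℝ => ∫ t in Ioi (0:ℝ),
      x ^ (p - 1) * (t ^ (c - 1) * (1 + t) ^ d * Real.exp (-((1 + t) * x)))) (Ioi 0) ∧
    ∫ x in Ioi (0:ℝ), ∫ t in Ioi (0:ℝ),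
      x ^ (p - 1) * (t ^ (c - 1) * (1 + t) ^ d * Real.exp (-((1 + t) * x)))
      = Real.Gamma p * (Real.Gamma c * Real.Gamma (p - d - c) / Real.Gamma (p - d)) := by
  set F : ℝ × ℝ → ℝ := fun z =>
    z.1 ^ (p - 1) * (z.2 ^ (c - 1) * (1 + z.2) ^ d * Real.exp (-((1 + z.2) * z.1))) with hF
  set μ : Measure ℝ := volume.restrict (Ioi (0:ℝ)) with hμ
  have gp := Real.Gamma_pos_of_pos hp
  have gc := Real.Gamma_pos_of_pos hc
  have gd := Real.Gamma_pos_of_pos hd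
  have gpd : 0 < Real.Gamma (p - d) := Real.Gamma_pos_of_pos (by linarith)
  have hFm : Measurable F := by rw [hF]; fun_prop
  have hpos : 0 ≤ᵐ[μ.prod μ] F := by
    rw [hμ, Measure.prod_restrict]
    filter_upwards [ae_restrict_mem (measurableSet_Ioi.prod measurableSet_Ioi)] with z hz
    have h1 : 0 < z.1 := hz.1
    have h2 : 0 < z.2 := hz.2
    simp only [Pi.zero_apply, hF]
    positivity
  have hl : ∫⁻ z, ENNReal.ofReal (F z) ∂(μ.prod μ) = ENNReal.ofReal
      (Real.Gamma p * (Real.Gamma c * Real.Gamma (p - d - c) / Real.Gamma (p - d))) := by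
    rw [lintegral_prod_symm _ (by fun_prop), ENNReal.ofReal_mul gp.le]
    have hb := aux_beta c (p - d - c) hc hd
    rw [show c + (p - d - c) = p - d by ring] at hb
    rw [← hb, ← lintegral_const_mul _ (by fun_prop)]
    apply setLIntegral_congr_fun measurableSet_Ioi
    intro t ht
    have ht : 0 < t := ht
    have e : ∀ x : ℝ, F (x, t) = (t ^ (c - 1) * (1 + t) ^ d) *
        (x ^ (p - 1) * Real.exp (-((1 + t) * x))) := by
      intro x; simp only [hF]; ring
    have h0 : 0 ≤ t ^ (c - 1) * (1 + t) ^ d := by positivity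
    simp only [e, ENNReal.ofReal_mul h0]
    rw [lintegral_const_mul _ (by fun_prop), aux_gamma _ _ hp (by positivity),
      ← ENNReal.ofReal_mul h0, ← ENNReal.ofReal_mul gp.le]
    congr 1
    rw [show -(p - d) = d + -p by ring, Real.rpow_add (by positivity)]; ring
  have hint : Integrable F (μ.prod μ) := by
    refine ⟨hFm.aestronglyMeasurable, ?_⟩
    rw [hasFiniteIntegral_iff_ofReal hpos, hl]
    exact ENNReal.ofReal_lt_top
  refine ⟨hint.integral_prod_left, ?_⟩
  have h := integral_prod F hint
  rw [integral_eq_lintegral_of_nonneg_ae hpos hFm.aestronglyMeasurable, hl,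
    ENNReal.toReal_ofReal (by positivity)] at h
  exact h.symm

theorem moments_of_W (a b c : ℝ) (ha : a > -1) (hb : b > -1) (hc : c > max 0 (a - b)) (k : ℕ) :
    IntegrableOn (fun x : ℝ => x ^ k * W a b c x) (Set.Ioi 0) ∧
    ∫ x in Set.Ioi (0:ℝ), x ^ k * W a b c x
      = poch (a + 1) k * poch (b + 1) k / poch (c + b + 1) k := by
  have hc0 : 0 < c := lt_of_le_of_lt (le_max_left _ _) hc
  have ha1 : 0 < a + 1 := by linarith
  have hb1 : 0 < b + 1 := by linarith
  have hcb : 0 < c + b + 1 := by linarith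
  have hk : (0:ℝ) ≤ k := k.cast_nonneg
  obtain ⟨h1, h2⟩ := aux_double (a + 1 + k) c (a - b - c) (by positivity) hc0 (by linarith)
  have gA := Real.Gamma_pos_of_pos ha1
  have gB := Real.Gamma_pos_of_pos hb1
  have gC := Real.Gamma_pos_of_pos hc0
  have gD := Real.Gamma_pos_of_pos hcb
  set K := Real.Gamma (c + b + 1) / (Real.Gamma (a + 1) * Real.Gamma (b + 1)) *
    (1 / Real.Gamma c) with hK
  have e : ∀ x ∈ Ioi (0:ℝ), K * (∫ t in Ioi (0:ℝ), x ^ (a + 1 + k - 1) *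
      (t ^ (c - 1) * (1 + t) ^ (a - b - c) * Real.exp (-((1 + t) * x)))) = x ^ k * W a b c x := by
    intro x hx
    have hx : 0 < x := hx
    have e1 : ∀ t : ℝ, x ^ (a + 1 + k - 1) *
      (t ^ (c - 1) * (1 + t) ^ (a - b - c) * Real.exp (-((1 + t) * x))) =
      (x ^ k * x ^ a * Real.exp (-x)) *
        (t ^ (c - 1) * (1 + t) ^ (a - b + 1 - c - 1) * Real.exp (-t * x)) := by
      intro t
      rw [show a + 1 + (k:ℝ) - 1 = k + a by ring, Real.rpow_add hx, Real.rpow_natCast,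
        show -((1 + t) * x) = -x + -t * x by ring, Real.exp_add,
        show a - b + 1 - c - 1 = a - b - c by ring]
      ring
    simp only [e1]
    rw [integral_const_mul, W, TricomiU, hK]
    ring
  refine ⟨IntegrableOn.congr_fun (h1.const_mul K) e measurableSet_Ioi, ?_⟩
  rw [← setIntegral_congr_fun measurableSet_Ioi e, integral_const_mul, h2,
    show a + 1 + (k:ℝ) - (a - b - c) - c = b + 1 + k by ring,
    show a + 1 + (k:ℝ) - (a - b - c) = c + b + 1 + k by ring,
    aux_poch _ ha1, aux_poch _ hb1, aux_poch _ hcb, hK]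
  have : 0 < poch (c + b + 1) k := Finset.prod_pos (fun i _ => by positivity)
  field_simp
end

section
/- Let a > −1, b > −1 and c > max{0, a−b} be real numbers. Then there exists a finite positive Borel measure σ on ℝ, supported on (−∞, 0], such that for every x > 0, W(x; a, b, c+1) / W(x; a, b, c) = ∫ (1/(x − t)) dσ(t). (In particular the pair (W(·; a, b, c), W(·; a, b, c+1)) forms a Nikishin system on (0, ∞).) -/
open MeasureTheory Filter Set

lemma maxp {p q δ : ℕ → ℝ} (hp : ∀ k, 0 < p k) (hq : ∀ k, 0 < q k) {x : ℝ} (hx : 0 ≤ x) (N : ℕ)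
    (h0 : δ 0 = 0)
    (hr : ∀ k ≤ N, (x + p k + q k) * δ (k+1) = q k * δ (k+2) + p k * δ k) :
    ∀ k ≤ N + 1, |δ k| ≤ |δ (k+1)| := by
  intro k
  induction k with
  | zero => intro _; simp [h0]
  | succ k ih =>
    intro hk
    have h1 := ih (by omega)
    have h2 := hr k (by omega)
    have h3 : (x + p k + q k) * |δ (k+1)| ≤ q k * |δ (k+2)| + p k * |δ k| := by
      have := congrArg abs h2
      rw [abs_mul, abs_of_pos (by have := hp k; have := hq k; linarith)] at this
      rw [this]
      refine (abs_add_le _ _).trans ?_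
      rw [abs_mul, abs_mul, abs_of_pos (hp k), abs_of_pos (hq k)]
    have h4 : q k * |δ (k+1)| ≤ q k * |δ (k+2)| := by
      have h5 := mul_le_mul_of_nonneg_left h1 (hp k).le
      have h6 := mul_nonneg hx (abs_nonneg (δ (k+1)))
      nlinarith
    exact le_of_mul_le_mul_left h4 (hq k)

lemma maxp' {p q δ : ℕ → ℝ} (hp : ∀ k, 0 < p k) (hq : ∀ k, 0 < q k) {x : ℝ} (hx : 0 ≤ x) (N : ℕ)
    (h0 : δ 0 = 0)
    (hr : ∀ k ≤ N, (x + p k + q k) * δ (k+1) = q k * δ (k+2) + p k * δ k) :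
    ∀ k ≤ N + 2, |δ k| ≤ |δ (N+2)| := by
  intro k hk
  have h := maxp hp hq hx N h0 hr
  induction hk using Nat.decreasingInduction with
  | of_succ k hk ih => exact (h k (by omega)).trans ih
  | self => exact le_rfl

def Tm (p q : ℕ → ℝ) (i j : ℕ) : ℝ :=
  (if j = i then p i + q i else 0) + (if j = i + 1 then - q i else 0) +
    (if j + 1 = i then - p i else 0)

lemma Tm_row (p q h : ℕ → ℝ) (N : ℕ) (h0 : h 0 = 0) (hN : h (N+2) = 0) (i : ℕ) (hi : i ≤ N) :
    ∑ j : Fin (N+1), Tm p q i j * h (j+1) =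
      (p i + q i) * h (i+1) - q i * h (i+2) - p i * h i := by
  rw [Fin.sum_univ_eq_sum_range (fun j => Tm p q i j * h (j+1))]
  have e3 : ∑ j ∈ Finset.range (N+1), (if j + 1 = i then - p i * h (j+1) else 0) = - p i * h i := by
    cases i with
    | zero => simp [h0]
    | succ i =>
      simp only [Nat.add_right_cancel_iff]
      rw [Finset.sum_ite_eq']
      simp; omega
  have e2 : ∑ j ∈ Finset.range (N+1), (if j = i + 1 then - q i * h (j+1) else 0)
      = - q i * h (i+2) := by
    rw [Finset.sum_ite_eq']
    split_ifs with hh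
    · rfl
    · have : i = N := by simp at hh; omega
      subst this
      simp [hN]
  have e1 : ∑ j ∈ Finset.range (N+1), (if j = i then (p i + q i) * h (j+1) else 0)
      = (p i + q i) * h (i+1) := by
    rw [Finset.sum_ite_eq']
    simp; omega
  have : ∀ j, Tm p q i j * h (j+1) = (if j = i then (p i + q i) * h (j+1) else 0)
      + (if j = i + 1 then - q i * h (j+1) else 0) + (if j + 1 = i then - p i * h (j+1) else 0) := by
    intro j; unfold Tm; split_ifs <;> ring
  simp only [this, Finset.sum_add_distrib, e1, e2, e3]
  ring

noncomputable def wt (p q : ℕ → ℝ) : ℕ → ℝ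
  | 0 => 1
  | k+1 => wt p q k * q k / p (k+1)

lemma wt_pos {p q : ℕ → ℝ} (hp : ∀ k, 0 < p k) (hq : ∀ k, 0 < q k) (k : ℕ) : 0 < wt p q k := by
  induction k with
  | zero => simp [wt]
  | succ k ih => have := hp (k+1); have := hq k; simp only [wt]; positivity

lemma Tm_symm {p q : ℕ → ℝ} (hp : ∀ k, 0 < p k) (i j : ℕ) :
    wt p q i * Tm p q i j = wt p q j * Tm p q j i := by
  unfold Tm
  rcases lt_trichotomy i j with h | h | h
  · by_cases hj : j = i + 1
    · subst hj
      have := (hp (i+1)).ne'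
      simp [wt, show ∀ n : ℕ, ¬ n + 1 + 1 = n by omega, show ∀ n : ℕ, ¬ n = n + 1 + 1 by omega]
      field_simp
    · have : ¬ j = i := by omega
      have : ¬ i = j := by omega
      have : ¬ j + 1 = i := by omega
      have : ¬ i + 1 = j := by omega
      have : ¬ i = j + 1 := by omega
      simp [*]
  · subst h; simp
  · by_cases hj : i = j + 1
    · subst hj
      have := (hp (j+1)).ne'
      simp [wt, show ∀ n : ℕ, ¬ n + 1 + 1 = n by omega, show ∀ n : ℕ, ¬ n = n + 1 + 1 by omega]
      field_simp
    · have : ¬ j = i := by omega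
      have : ¬ i = j := by omega
      have : ¬ j + 1 = i := by omega
      have : ¬ i + 1 = j := by omega
      have : ¬ j = i + 1 := by omega
      simp [*]

noncomputable def Jm (p q : ℕ → ℝ) (N : ℕ) : Matrix (Fin (N+1)) (Fin (N+1)) ℝ :=
  fun i j => Real.sqrt (wt p q i) * Tm p q i j / Real.sqrt (wt p q j)

lemma Jm_herm {p q : ℕ → ℝ} (hp : ∀ k, 0 < p k) (hq : ∀ k, 0 < q k) (N : ℕ) :
    (Jm p q N).IsHermitian := by
  ext i j
  simp only [Matrix.conjTranspose_apply, star_trivial, Jm]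
  have h := Tm_symm hp (q := q) i j
  have hi := wt_pos hp hq i
  have hj := wt_pos hp hq j
  have hi' := Real.sqrt_pos.2 hi
  have hj' := Real.sqrt_pos.2 hj
  rw [div_eq_div_iff hi'.ne' hj'.ne']
  have e1 := Real.mul_self_sqrt hi.le
  have e2 := Real.mul_self_sqrt hj.le
  calc _ = (Real.sqrt (wt p q j) * Real.sqrt (wt p q j)) * Tm p q j i := by ring
    _ = (Real.sqrt (wt p q i) * Real.sqrt (wt p q i)) * Tm p q i j := by rw [e1, e2, h]
    _ = _ := by ring

/-- zero extension and rescaling -/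
noncomputable def zext (p q : ℕ → ℝ) (N : ℕ) (φ : Fin (N+1) → ℝ) : ℕ → ℝ
  | 0 => 0
  | k+1 => if h : k < N + 1 then φ ⟨k, h⟩ / Real.sqrt (wt p q k) else 0

lemma zext_succ (p q : ℕ → ℝ) (N : ℕ) (φ : Fin (N+1) → ℝ) (k : ℕ) (h : k < N + 1) :
    zext p q N φ (k+1) = φ ⟨k, h⟩ / Real.sqrt (wt p q k) := by
  simp only [zext]
  exact dif_pos h

lemma Jm_mulVec {p q : ℕ → ℝ} (N : ℕ) (φ : Fin (N+1) → ℝ) (i : Fin (N+1)) :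
    (Jm p q N).mulVec φ i = Real.sqrt (wt p q i) *
      ((p i + q i) * zext p q N φ (i+1) - q i * zext p q N φ (i+2) - p i * zext p q N φ i) := by
  rw [← Tm_row p q (zext p q N φ) N rfl (by simp [zext]) i (by omega), Finset.mul_sum]
  simp only [Matrix.mulVec, dotProduct, Jm]
  refine Finset.sum_congr rfl fun j _ => ?_
  rw [zext_succ p q N φ j j.2]
  simp only [Fin.eta]
  ring

lemma spectral {p q : ℕ → ℝ} (hp : ∀ k, 0 < p k) (hq : ∀ k, 0 < q k) (N : ℕ) :
    ∃ (m l : Fin (N+1) → ℝ), (∀ i, 0 ≤ m i) ∧ (∑ i, m i = 1) ∧ (∀ i, 0 ≤ l i) ∧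
      ∀ x > 0, ∃ g : ℕ → ℝ, g 0 = 1 / p 0 ∧ g (N+2) = 0 ∧
        (∀ k ≤ N, (x + p k + q k) * g (k+1) = q k * g (k+2) + p k * g k) ∧
        g 1 = ∑ i, m i / (x + l i) := by
  have hJ := Jm_herm hp hq N
  set J := Jm p q N with hJdef
  set B := hJ.eigenvectorBasis with hB
  set l := hJ.eigenvalues with hl
  have hBe : ∀ i, J.mulVec (B i) = l i • (B i : Fin (N+1) → ℝ) := hJ.mulVec_eigenvectorBasis
  have hsq : ∀ k, 0 < Real.sqrt (wt p q k) := fun k => Real.sqrt_pos.2 (wt_pos hp hq k)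
  have hl0 : ∀ i, 0 ≤ l i := by
    intro i
    by_contra hneg
    push Not at hneg
    have hrec : ∀ k ≤ N, (-l i + p k + q k) * zext p q N (B i) (k+1) =
        q k * zext p q N (B i) (k+2) + p k * zext p q N (B i) k := by
      intro k hk
      have h1 := congrFun (hBe i) ⟨k, by omega⟩
      rw [hJdef, Jm_mulVec] at h1
      have h2 : zext p q N (B i) (k+1) = B i ⟨k, by omega⟩ / Real.sqrt (wt p q k) := zext_succ _ _ _ _ _ _
      have h3 : B i ⟨k, by omega⟩ = Real.sqrt (wt p q k) * zext p q N (B i) (k+1) := by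
        rw [h2]; field_simp [(hsq k).ne']
      simp only [Pi.smul_apply, smul_eq_mul] at h1
      rw [h3] at h1
      have h4 : Real.sqrt (wt p q k) * ((p k + q k) * zext p q N (B i) (k+1)
        - q k * zext p q N (B i) (k+2) - p k * zext p q N (B i) k) =
        Real.sqrt (wt p q k) * (l i * zext p q N (B i) (k+1)) := by
        rw [h1]; ring
      have h5 := mul_left_cancel₀ (hsq k).ne' h4
      linarith
    have hz := maxp' hp hq (by linarith : 0 ≤ -l i) N rfl hrec
    have hz0 : zext p q N (B i) (N+2) = 0 := by simp [zext]
    have : B i = 0 := by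
      ext j
      have h1 := hz (j+1) (by omega)
      rw [hz0, abs_zero] at h1
      have h2 := abs_nonpos_iff.1 h1
      have h3 : zext p q N (B i) (j+1) = B i j / Real.sqrt (wt p q j) := zext_succ _ _ _ _ _ j.2
      rw [h3, div_eq_zero_iff] at h2
      simpa [(hsq j).ne'] using h2
    have h1 := B.norm_eq_one i
    rw [this] at h1
    simp at h1
  refine ⟨fun i => (B i 0)^2, l, fun i => sq_nonneg _, ?_, hl0, ?_⟩
  · have h := B.sum_sq_norm_inner_right (EuclideanSpace.single 0 (1:ℝ))
    simpa [EuclideanSpace.inner_single_right] using h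
  intro x hx
  have hxl : ∀ i, x + l i ≠ 0 := fun i => by have := hl0 i; positivity
  set φ : Fin (N+1) → ℝ := ∑ i, (B i 0 / (x + l i)) • (B i : Fin (N+1) → ℝ) with hφ
  have hφ0 : φ 0 = ∑ i, (B i 0)^2 / (x + l i) := by
    simp only [hφ, Finset.sum_apply, Pi.smul_apply, smul_eq_mul]
    exact Finset.sum_congr rfl fun i _ => by ring
  have hsolve : ∀ k, x * φ k + J.mulVec φ k = if k = 0 then 1 else 0 := by
    intro k
    have h1 : J.mulVec φ = ∑ i, (B i 0 / (x + l i)) • (l i • (B i : Fin (N+1) → ℝ)) := by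
      rw [hφ, Matrix.mulVec_sum]
      refine Finset.sum_congr rfl fun i _ => ?_
      rw [Matrix.mulVec_smul, hBe]
    have h2 : ∑ i, B i 0 * B i k = if k = 0 then 1 else 0 := by
      have h := B.sum_repr' (EuclideanSpace.single 0 (1:ℝ))
      have h' := congrArg (fun v : EuclideanSpace ℝ (Fin (N+1)) => v k) h
      simpa [EuclideanSpace.inner_single_right] using h'
    rw [← h2, h1, hφ]
    simp only [Finset.sum_apply, Pi.smul_apply, smul_eq_mul, Finset.mul_sum]
    rw [← Finset.sum_add_distrib]
    refine Finset.sum_congr rfl fun i _ => ?_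
    have := hxl i
    field_simp
  refine ⟨fun k => if k = 0 then 1 / p 0 else zext p q N φ k, by simp, by simp [zext], ?_, ?_⟩
  · intro k hk
    have h1 := hsolve ⟨k, by omega⟩
    rw [hJdef, Jm_mulVec] at h1
    have h2 : zext p q N φ (k+1) = φ ⟨k, by omega⟩ / Real.sqrt (wt p q k) := zext_succ _ _ _ _ _ _
    have h3 : φ ⟨k, by omega⟩ = Real.sqrt (wt p q k) * zext p q N φ (k+1) := by
      rw [h2]; field_simp [(hsq k).ne']
    rw [h3] at h1
    simp only at h1
    by_cases hk0 : k = 0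
    · subst hk0
      have := (hp 0).ne'
      simp [wt, zext] at h1 ⊢
      rw [mul_inv_cancel₀ this]
      linarith
    · rw [if_neg (by simpa [Fin.ext_iff] using hk0)] at h1
      have h4 : Real.sqrt (wt p q k) * (x * zext p q N φ (k+1) + ((p k + q k) * zext p q N φ (k+1)
        - q k * zext p q N φ (k+2) - p k * zext p q N φ k)) = 0 := by
        rw [← h1]; ring
      have h5 := (mul_eq_zero.1 h4).resolve_left (hsq k).ne'
      simp [hk0]
      linarith
  · rw [← hφ0]
    simp [zext, wt]


noncomputable def kern (x : ℝ) (hx : 0 < x) : BoundedContinuousFunction (Icc (0:ℝ) 1) ℝ :=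
  BoundedContinuousFunction.mkOfCompact ⟨fun s => (s:ℝ) / (1 + (x-1) * s), by
    refine Continuous.div (by fun_prop) (by fun_prop) ?_
    rintro ⟨s, h0, h1⟩
    simp only
    have : 0 < 1 + (x-1)*s := by
      rcases h0.eq_or_lt with h | h
      · rw [← h]; simp
      · nlinarith
    exact this.ne'⟩

lemma limit_measure (μ : ℕ → ProbabilityMeasure (Icc (0:ℝ) 1)) (R : ℝ → ℝ)
    (h : ∀ x > 0, Tendsto (fun N => ∫ s, (s:ℝ) / (1 + (x-1) * s) ∂(μ N : Measure (Icc (0:ℝ) 1)))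
      atTop (nhds (R x))) :
    ∃ σ : Measure ℝ, IsFiniteMeasure σ ∧ σ (Set.Ioi 0) = 0 ∧
      ∀ x > (0:ℝ), R x = ∫ t, (x - t)⁻¹ ∂σ := by
  obtain ⟨ν, hν⟩ := exists_clusterPt_of_compactSpace (Filter.map μ atTop)
  have hν' : MapClusterPt ν atTop μ := hν
  have key : ∀ x > 0, ∫ s, (s:ℝ) / (1 + (x-1) * s) ∂(ν : Measure (Icc (0:ℝ) 1)) = R x := by
    intro x hx
    have hc : Continuous fun m : ProbabilityMeasure (Icc (0:ℝ) 1) => ∫ s, kern x hx s ∂(m : Measure (Icc (0:ℝ) 1)) :=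
      ProbabilityMeasure.continuous_integral_boundedContinuousFunction (kern x hx)
    have h1 := hν'.continuousAt_comp (hc.continuousAt (x := ν))
    have h2 : Tendsto ((fun m : ProbabilityMeasure (Icc (0:ℝ) 1) => ∫ s, kern x hx s ∂(m : Measure (Icc (0:ℝ) 1))) ∘ μ) atTop (nhds (R x)) := h x hx
    have : (nhds _ ⊓ nhds (R x)).NeBot := Filter.NeBot.mono h1 (inf_le_inf_left _ h2)
    exact eq_of_nhds_neBot this
  set f : Icc (0:ℝ) 1 → ℝ := fun s => 1 - 1 / (s:ℝ) with hf
  have hfm : Measurable f := by fun_prop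
  set P : Set (Icc (0:ℝ) 1) := {s | (0:ℝ) < s} with hP
  have hPm : MeasurableSet P := measurableSet_lt measurable_const measurable_subtype_coe
  refine ⟨((ν : Measure (Icc (0:ℝ) 1)).restrict P).map f, inferInstance, ?_, ?_⟩
  · rw [Measure.map_apply hfm measurableSet_Ioi, Measure.restrict_apply (hfm measurableSet_Ioi)]
    convert measure_empty (μ := (ν : Measure (Icc (0:ℝ) 1)))
    ext ⟨s, h0, h1⟩
    simp only [hf, hP, mem_inter_iff, mem_preimage, mem_Ioi, mem_ofPred_eq, mem_empty_iff_false,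
      iff_false, not_and, not_lt]
    intro h2
    by_contra h3
    push Not at h3
    have := one_le_one_div h3 h1
    linarith
  · intro x hx
    rw [← key x hx, integral_map hfm.aemeasurable (by fun_prop)]
    rw [← integral_indicator hPm]
    refine integral_congr_ae (Eventually.of_forall ?_)
    rintro ⟨s, h0, h1⟩
    rcases h0.eq_or_lt with h | h
    · subst h
      rw [indicator_of_notMem (show (⟨0, h0, h1⟩ : Icc (0:ℝ) 1) ∉ P from fun hh => lt_irrefl (0:ℝ) hh)]
      simp
    · have : 0 < 1 + (x-1)*s := by nlinarith
      rw [indicator_of_mem (show (⟨s, h0, h1⟩ : Icc (0:ℝ) 1) ∈ P from h)]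
      simp only [hf]
      have e : x - (1 - 1 / s) = (1 + (x-1)*s) / s := by field_simp; ring
      rw [e, inv_div]

lemma discrete {n : ℕ} (m l : Fin n → ℝ) (hm : ∀ i, 0 ≤ m i) (hs : ∑ i, m i = 1)
    (hl : ∀ i, 0 ≤ l i) : ∃ μ : ProbabilityMeasure (Icc (0:ℝ) 1), ∀ x > 0,
      ∫ s, (s:ℝ) / (1 + (x-1) * s) ∂(μ : Measure (Icc (0:ℝ) 1)) = ∑ i, m i / (x + l i) := by
  let s : Fin n → Icc (0:ℝ) 1 := fun i => ⟨1 / (1 + l i), by have := hl i; positivity, by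
    have := hl i
    rw [div_le_one (by positivity)]; linarith⟩
  let μ : Measure (Icc (0:ℝ) 1) := ∑ i, ENNReal.ofReal (m i) • Measure.dirac (s i)
  have hμ : IsProbabilityMeasure μ := by
    constructor
    simp only [μ, Measure.coe_finsetSum, Finset.sum_apply, Measure.smul_apply, measure_univ,
      smul_eq_mul, mul_one]
    rw [← ENNReal.ofReal_sum_of_nonneg (fun i _ => hm i), hs, ENNReal.ofReal_one]
  refine ⟨⟨μ, hμ⟩, fun x hx => ?_⟩
  simp only [ProbabilityMeasure.coe_mk, μ]
  rw [integral_finsetSum_measure]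
  · refine Finset.sum_congr rfl fun i _ => ?_
    rw [integral_smul_measure, integral_dirac, ENNReal.toReal_ofReal (hm i)]
    simp only [s, smul_eq_mul]
    have := hl i
    have h1 : 1 + l i ≠ 0 := by positivity
    have h2 : x + l i ≠ 0 := by positivity
    have e : 1 + (x - 1) * (1 / (1 + l i)) = (x + l i) / (1 + l i) := by field_simp; ring
    rw [e]
    field_simp
  · intro i _
    exact (integrable_dirac (by simp)).smul_measure ENNReal.ofReal_ne_top



noncomputable def ig (s r x t : ℝ) : ℝ := t ^ s * (1 + t) ^ r * Real.exp (-t * x)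

lemma ig_bound (s r x : ℝ) (hx : 0 < x) : ∃ C : ℝ, ∀ t > 0,
    ig s r x t ≤ C * (t ^ s * Real.exp (-(x/2) * t)) := by
  obtain ⟨n, hn⟩ := exists_nat_ge r
  refine ⟨n.factorial * (2/x)^n * Real.exp (x/2), fun t ht => ?_⟩
  have h1 : (1 + t) ^ r ≤ (1 + t) ^ n := by
    rw [← Real.rpow_natCast]
    exact Real.rpow_le_rpow_of_exponent_le (by linarith) hn
  have h2 := Real.pow_div_factorial_le_exp (x/2 * (1+t)) (by positivity) n
  rw [div_le_iff₀ (by positivity)] at h2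
  have h3 : (1+t)^n ≤ n.factorial * (2/x)^n * (Real.exp (x/2) * Real.exp (x/2*t)) := by
    rw [← Real.exp_add, show x/2 + x/2*t = x/2*(1+t) by ring]
    calc (1+t)^n = (2/x)^n * (x/2*(1+t))^n := by rw [← mul_pow]; congr 1; field_simp
      _ ≤ (2/x)^n * (Real.exp (x/2*(1+t)) * n.factorial) := by gcongr
      _ = _ := by ring
  have h4 : Real.exp (-t*x) = Real.exp (-(x/2)*t) * Real.exp (-(x/2)*t) := by
    rw [← Real.exp_add]; congr 1; ring
  have h5 : Real.exp (x/2*t) * Real.exp (-(x/2)*t) = 1 := by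
    rw [← Real.exp_add]; simp
  unfold ig
  calc t ^ s * (1 + t) ^ r * Real.exp (-t * x)
      ≤ t ^ s * (n.factorial * (2/x)^n * (Real.exp (x/2) * Real.exp (x/2*t))) * Real.exp (-t*x) := by
        gcongr; exact h1.trans h3
    _ = n.factorial * (2/x)^n * Real.exp (x/2) * (t^s * Real.exp (-(x/2)*t)) *
        (Real.exp (x/2*t) * Real.exp (-(x/2)*t)) := by rw [h4]; ring
    _ = _ := by rw [h5]; ring

lemma ig_pos (s r x t : ℝ) (ht : 0 < t) : 0 < ig s r x t := by
  unfold ig; positivity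

lemma ig_cont (s r x : ℝ) : ContinuousOn (ig s r x) (Ioi 0) := by
  intro t ht
  have ht' : 0 < t := ht
  unfold ig
  refine ContinuousAt.continuousWithinAt ?_
  refine ((Real.continuousAt_rpow_const _ _ (Or.inl ht'.ne')).mul ?_).mul (by fun_prop)
  exact ContinuousAt.rpow_const (by fun_prop) (Or.inl (by positivity))

lemma ig_int (s r x : ℝ) (hs : -1 < s) (hx : 0 < x) : IntegrableOn (ig s r x) (Ioi 0) := by
  obtain ⟨C, hC⟩ := ig_bound s r x hx
  have h := (integrableOn_rpow_mul_exp_neg_mul_rpow hs one_pos (half_pos hx)).const_mul C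
  refine Integrable.mono' h ((ig_cont s r x).aestronglyMeasurable measurableSet_Ioi) ?_
  refine (ae_restrict_iff' measurableSet_Ioi).2 (Eventually.of_forall fun t ht => ?_)
  rw [Real.norm_of_nonneg (ig_pos s r x t ht).le]
  simpa using hC t ht

lemma ig_tendsto (s r x : ℝ) (hx : 0 < x) : Tendsto (ig s r x) atTop (nhds 0) := by
  obtain ⟨C, hC⟩ := ig_bound s r x hx
  have h := (tendsto_rpow_mul_exp_neg_mul_atTop_nhds_zero s (x/2) (half_pos hx)).const_mul C
  rw [mul_zero] at h
  refine tendsto_of_tendsto_of_tendsto_of_le_of_le' tendsto_const_nhds h ?_ ?_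
  · filter_upwards [eventually_gt_atTop 0] with t ht using (ig_pos s r x t ht).le
  · filter_upwards [eventually_gt_atTop 0] with t ht using hC t ht

noncomputable def FF (c β x : ℝ) (k : ℕ) : ℝ := ∫ t in Ioi (0:ℝ), ig (c + k - 1) (β - c - k - 1) x t

lemma FF_pos (c β x : ℝ) (hc : 0 < c) (hx : 0 < x) (k : ℕ) : 0 < FF c β x k := by
  unfold FF
  rw [setIntegral_pos_iff_support_of_nonneg_ae]
  · have : Function.support (ig (c + k - 1) (β - c - k - 1) x) ∩ Ioi 0 = Ioi 0 :=
      inter_eq_right.2 fun t ht => (ig_pos _ _ _ _ ht).ne'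
    rw [this]; simp
  · exact (ae_restrict_iff' measurableSet_Ioi).2 (Eventually.of_forall fun t ht => (ig_pos _ _ _ _ ht).le)
  · exact ig_int _ _ _ (by have : (0:ℝ) ≤ k := k.cast_nonneg; linarith) hx

lemma FF_rec (c β x : ℝ) (hc : 0 < c) (hx : 0 < x) (k : ℕ) :
    (x + (c + k) + (c + k + 2 - β)) * FF c β x (k+1) =
      (c + k + 2 - β) * FF c β x (k+2) + (c + k) * FF c β x k := by
  have hk : (0:ℝ) ≤ k := k.cast_nonneg
  set i0 := ig (c + k - 1) (β - c - k - 1) x with hi0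
  set i1 := ig (c + (k+1:ℕ) - 1) (β - c - (k+1:ℕ) - 1) x with hi1
  set i2 := ig (c + (k+2:ℕ) - 1) (β - c - (k+2:ℕ) - 1) x with hi2
  have I0 : IntegrableOn i0 (Ioi 0) := ig_int _ _ _ (by linarith) hx
  have I1 : IntegrableOn i1 (Ioi 0) := ig_int _ _ _ (by push_cast; linarith) hx
  have I2 : IntegrableOn i2 (Ioi 0) := ig_int _ _ _ (by push_cast; linarith) hx
  let f' : ℝ → ℝ := fun t => (c + k) * i0 t - (x + (c + k) + (c + k + 2 - β)) * i1 t
    + (c + k + 2 - β) * i2 t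
  have hder : ∀ t ∈ Ioi (0:ℝ), HasDerivAt (ig (c + k) (β - c - k - 2) x) (f' t) t := by
    intro t ht
    have ht : 0 < t := ht
    have d1 := Real.hasDerivAt_rpow_const (x := t) (p := c + k) (Or.inl ht.ne')
    have d2 := ((hasDerivAt_id t).const_add 1).rpow_const (p := β - c - k - 2)
      (Or.inl (by simp; positivity))
    have d3 := ((hasDerivAt_id t).neg.mul_const x).exp
    refine ((d1.mul d2).mul d3).congr_deriv ?_
    simp only [f', hi0, hi1, hi2, ig, id, Pi.mul_apply, Pi.neg_apply]
    have e1 : t ^ (c + k) = t * t ^ (c + k - 1) := by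
      rw [Real.rpow_sub_one ht.ne']; field_simp
    have e2 : t ^ (c + (k+1:ℕ) - 1) = t * t ^ (c + k - 1) := by
      rw [← e1]; push_cast; congr 1; ring
    have e3 : t ^ (c + (k+2:ℕ) - 1) = t * (t * t ^ (c + k - 1)) := by
      rw [← e1, show c + ((k+2:ℕ):ℝ) - 1 = c + k + 1 by push_cast; ring,
        Real.rpow_add_one ht.ne']; ring
    have h1t : 1 + t ≠ 0 := by positivity
    have g1 : (1 + t) ^ (β - c - k - 2) = (1+t) * (1+t) ^ (β - c - k - 2 - 1) := by
      rw [Real.rpow_sub_one h1t]; field_simp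
    have g2 : (1 + t) ^ (β - c - (k+1:ℕ) - 1) = (1 + t) ^ (β - c - k - 2) := by
      congr 1; push_cast; ring
    have g3 : (1 + t) ^ (β - c - (k+2:ℕ) - 1) = (1 + t) ^ (β - c - k - 2 - 1) := by
      congr 1; push_cast; ring
    have g0 : (1 + t) ^ (β - c - k - 1) = (1 + t) * (1 + t) ^ (β - c - k - 2) := by
      rw [show β - c - k - 1 = β - c - k - 2 + 1 by ring, Real.rpow_add_one h1t]; ring
    rw [e2, e3, g2, g3, g0, e1, g1]
    ring
  have hfint : IntegrableOn f' (Ioi 0) :=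
    ((I0.const_mul _).sub (I1.const_mul _)).add (I2.const_mul _)
  have hcont : ContinuousWithinAt (ig (c + k) (β - c - k - 2) x) (Ici 0) 0 := by
    refine ContinuousAt.continuousWithinAt ?_
    unfold ig
    refine ((Real.continuousAt_rpow_const _ _ (Or.inr (by linarith))).mul ?_).mul (by fun_prop)
    exact ContinuousAt.rpow_const (by fun_prop) (Or.inl (by norm_num))
  have h := integral_Ioi_of_hasDerivAt_of_tendsto hcont hder hfint (ig_tendsto _ _ _ hx)
  have h0 : ig (c + k) (β - c - k - 2) x 0 = 0 := by
    simp [ig, Real.zero_rpow (by positivity : c + (k:ℝ) ≠ 0)]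
  rw [h0, sub_zero] at h
  simp only [f'] at h
  have I01 : Integrable (fun t => (c + k) * i0 t - (x + (c + k) + (c + k + 2 - β)) * i1 t)
      (volume.restrict (Ioi 0)) := (I0.const_mul _).sub (I1.const_mul _)
  rw [integral_add I01 (I2.const_mul _), integral_sub (I0.const_mul _) (I1.const_mul _), integral_const_mul, integral_const_mul,
    integral_const_mul] at h
  simp only [FF]
  linarith

lemma FF_tendsto (c β x : ℝ) (hc : 0 < c) (hx : 0 < x) :
    Tendsto (FF c β x) atTop (nhds 0) := by
  have key : ∀ k : ℕ, ∀ t > 0, ig (c + k - 1) (β - c - k - 1) x t =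
      (t / (1+t)) ^ k * ig (c - 1) (β - c - 1) x t := by
    intro k t ht
    have h1t : 0 < 1 + t := by positivity
    unfold ig
    rw [show c + k - 1 = c - 1 + k by ring, show β - c - k - 1 = β - c - 1 - k by ring,
      Real.rpow_add_natCast ht.ne', Real.rpow_sub_natCast h1t.ne', div_pow]
    field_simp
  have : Tendsto (fun k => FF c β x k) atTop (nhds (∫ t in Ioi (0:ℝ), (0:ℝ))) := by
    unfold FF
    refine tendsto_integral_of_dominated_convergence (ig (c-1) (β-c-1) x)
      (fun k => (ig_cont _ _ _).aestronglyMeasurable measurableSet_Ioi)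
      (ig_int _ _ _ (by linarith) hx) (fun k => ?_) ?_
    · refine (ae_restrict_iff' measurableSet_Ioi).2 (Eventually.of_forall fun t ht => ?_)
      have ht : 0 < t := ht
      rw [Real.norm_of_nonneg (ig_pos _ _ x t ht).le, key k t ht]
      refine mul_le_of_le_one_left (ig_pos _ _ x t ht).le (pow_le_one₀ (by positivity) ?_)
      rw [div_le_one (by positivity)]; linarith
    · refine (ae_restrict_iff' measurableSet_Ioi).2 (Eventually.of_forall fun t ht => ?_)
      have ht : 0 < t := ht
      simp only [key _ t ht]
      have h := tendsto_pow_atTop_nhds_zero_of_lt_one (r := t / (1+t)) (by positivity)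
        (by rw [div_lt_one (by positivity)]; linarith)
      simpa using h.mul_const (ig (c - 1) (β - c - 1) x t)
  simpa using this


lemma main_aux (c β : ℝ) (hc : 0 < c) (hβ : 0 < c + 1 - β) :
    ∃ σ : Measure ℝ, IsFiniteMeasure σ ∧ σ (Set.Ioi 0) = 0 ∧
      ∀ x > (0:ℝ), FF c β x 1 / (c * FF c β x 0) = ∫ t, (x - t)⁻¹ ∂σ := by
  set p : ℕ → ℝ := fun k => c + k with hpd
  set q : ℕ → ℝ := fun k => c + k + 2 - β with hqd
  have hp : ∀ k, 0 < p k := fun k => by simp only [hpd]; positivity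
  have hq : ∀ k, 0 < q k := fun k => by
    have : (0:ℝ) ≤ k := k.cast_nonneg
    simp only [hqd]; linarith
  choose m l hm hs hl hg using fun N => spectral hp hq N
  choose μ hμ using fun N => discrete (m N) (l N) (hm N) (hs N) (hl N)
  refine limit_measure μ (fun x => FF c β x 1 / (c * FF c β x 0)) fun x hx => ?_
  have hF0 := FF_pos c β x hc hx 0
  have hb : ∀ N, |(∑ i, m N i / (x + l N i)) - FF c β x 1 / (c * FF c β x 0)| ≤
      FF c β x (N+2) / (c * FF c β x 0) := by
    intro N
    obtain ⟨g, g0, gN, gr, g1⟩ := hg N x hx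
    have h := maxp' (δ := fun k => g k - FF c β x k / (c * FF c β x 0)) hp hq hx.le N ?_ ?_ 1
      (by omega)
    · simp only [g1, gN, zero_sub, abs_neg] at h
      rwa [abs_of_pos (div_pos (FF_pos c β x hc hx (N+2)) (mul_pos hc hF0))] at h
    · simp only [g0, hpd]
      field_simp
      simp
    · intro k hk
      have h1 := gr k hk
      have h2 := FF_rec c β x hc hx k
      simp only [hpd, hqd] at h1 ⊢
      have h3 : (x + (c + k) + (c + k + 2 - β)) * (FF c β x (k+1) / (c * FF c β x 0)) =
        (c + k + 2 - β) * (FF c β x (k+2) / (c * FF c β x 0))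
          + (c + k) * (FF c β x k / (c * FF c β x 0)) := by
        rw [← mul_div_assoc, h2]; ring
      linarith
  simp only [hμ _ x hx]
  rw [tendsto_iff_norm_sub_tendsto_zero]
  refine squeeze_zero (fun _ => norm_nonneg _) hb ?_
  have h := ((tendsto_add_atTop_iff_nat 2).2 (FF_tendsto c β x hc hx)).div_const (c * FF c β x 0)
  simpa using h

/-- The ratio `W(x; a,b,c+1) / W(x; a,b,c)` is the Stieltjes transform of a finite
positive measure supported on `(-∞, 0]`: the pair forms a Nikishin system. -/
theorem W_ratio_Nikishin (a b c : ℝ) (ha : a > -1) (hb : b > -1)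
    (hc : c > max 0 (a - b)) :
    ∃ σ : Measure ℝ, IsFiniteMeasure σ ∧ σ (Set.Ioi 0) = 0 ∧
      ∀ x > (0:ℝ), W a b (c + 1) x / W a b c x = ∫ t, (x - t)⁻¹ ∂σ := by
  obtain ⟨hc0, hc1⟩ := max_lt_iff.1 hc
  obtain ⟨σ, h1, h2, h3⟩ := main_aux c (a - b + 1) hc0 (by linarith)
  refine ⟨ENNReal.ofReal (c + b + 1) • σ, Measure.smul_finite _ ENNReal.ofReal_ne_top, by simp [h2], fun x hx => ?_⟩
  rw [integral_smul_measure, ← h3 x hx, ENNReal.toReal_ofReal (by linarith), smul_eq_mul]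
  have hU0 : TricomiU c (a - b + 1) x = 1 / Real.Gamma c * FF c (a-b+1) x 0 := by
    simp [TricomiU, FF, ig]
  have hU1 : TricomiU (c+1) (a - b + 1) x = 1 / (c * Real.Gamma c) * FF c (a-b+1) x 1 := by
    rw [← Real.Gamma_add_one hc0.ne']
    simp only [TricomiU, FF, ig, Nat.cast_one]
    congr 1
    refine integral_congr_ae (Eventually.of_forall fun t => ?_)
    simp only
    congr 3
    ring
  have hF0 := FF_pos c (a-b+1) x hc0 hx 0
  unfold W
  rw [hU0, hU1, show c + 1 + b + 1 = c + b + 1 + 1 by ring, Real.Gamma_add_one (by linarith)]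
  have g1 := Real.Gamma_pos_of_pos (show 0 < c + b + 1 by linarith)
  have g2 := Real.Gamma_pos_of_pos (show 0 < a + 1 by linarith)
  have g3 := Real.Gamma_pos_of_pos (show 0 < b + 1 by linarith)
  have g4 := Real.Gamma_pos_of_pos hc0
  have g5 := Real.rpow_pos_of_pos hx a
  have g6 := Real.exp_pos (-x)
  field_simp
end

section
/- Let a > −1, b > −1, c > max{0, a−b} be real numbers, d ∈ {0, 1}, and n ≥ 1 an integer. Define Q_n(x) = ((−1)^{n−1}/(n−1)!) (d/dx)^{n−1} W(x; a+n−1, b+n−1, c+⌊(n+d)/2⌋) for x > 0. Then ∫_0^∞ x^j Q_n(x) dx = 0 for every integer j with 0 ≤ j ≤ n−2, and ∫_0^∞ x^{n−1} Q_n(x) dx = 1. (Rodrigues formula: Q_n is the type I function of index n on the step line for the Nikishin system (W(·; a, b, c+d), W(·; a, b, c+1−d)).) -/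
open MeasureTheory Filter Set

/-- Rodrigues-type formula for the type I function of index `n` on the step line:
`Q_n(x) = ((-1)^(n-1)/(n-1)!) (d/dx)^(n-1) W(x; a+n-1, b+n-1, c+⌊(n+d)/2⌋)`. -/
noncomputable def QtypeI (a b c : ℝ) (d n : ℕ) (x : ℝ) : ℝ :=
  ((-1 : ℝ) ^ (n - 1) / (n - 1).factorial) *
    (deriv^[n - 1]
      (W (a + (n : ℝ) - 1) (b + (n : ℝ) - 1) (c + (((n + d) / 2 : ℕ) : ℝ)))) x

namespace RodAux

/-- `H C q x = ∫ t^(C-1) (1+t)^q e^{-(1+t)x} dt`. -/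
noncomputable def H (C q x : ℝ) : ℝ :=
  ∫ t in Set.Ioi (0:ℝ), t ^ (C - 1) * (1 + t) ^ q * Real.exp (-((1 + t) * x))

lemma contOn (C q x : ℝ) : ContinuousOn
    (fun t : ℝ => t ^ (C - 1) * (1 + t) ^ q * Real.exp (-((1 + t) * x))) (Ioi 0) := by
  refine ContinuousOn.mul (ContinuousOn.mul ?_ ?_) (by fun_prop)
  · exact continuousOn_id.rpow_const (fun t ht => Or.inl (ne_of_gt ht))
  · refine ContinuousOn.rpow_const (by fun_prop) (fun t ht => Or.inl ?_)
    have : (0:ℝ) < t := ht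
    positivity

lemma H_integrable {C : ℝ} (hC : 0 < C) (q : ℝ) {x : ℝ} (hx : 0 < x) :
    IntegrableOn (fun t : ℝ => t ^ (C - 1) * (1 + t) ^ q * Real.exp (-((1 + t) * x)))
      (Ioi 0) := by
  obtain ⟨N, hN⟩ := exists_nat_ge q
  have hG : IntegrableOn (fun t : ℝ => t ^ (C - 1) * Real.exp (-(x/2) * t ^ (1:ℝ))) (Ioi 0) :=
    integrableOn_rpow_mul_exp_neg_mul_rpow (by linarith) (by norm_num) (by positivity)
  refine Integrable.mono' (hG.const_mul (N.factorial / (x/2)^N))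
    ((contOn C q x).aestronglyMeasurable measurableSet_Ioi) ?_
  refine (ae_restrict_iff' measurableSet_Ioi).2 (Eventually.of_forall fun t ht => ?_)
  have ht : (0:ℝ) < t := ht
  rw [Real.norm_of_nonneg (by positivity), Real.rpow_one]
  have h1 : (1 + t) ^ q ≤ (1 + t) ^ N := by
    rw [← Real.rpow_natCast]
    exact Real.rpow_le_rpow_of_exponent_le (by linarith) hN
  have h2 := Real.pow_div_factorial_le_exp ((1 + t) * (x/2)) (by positivity) N
  have h3 : (1 + t) ^ N ≤ N.factorial / (x/2)^N * Real.exp ((1 + t) * (x/2)) := by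
    rw [mul_pow, div_le_iff₀ (by positivity)] at h2
    rw [div_mul_eq_mul_div, le_div_iff₀ (by positivity)]
    linarith
  have h4 : Real.exp ((1 + t) * (x/2)) * Real.exp (-((1 + t) * x)) ≤ Real.exp (-(x/2) * t) := by
    rw [← Real.exp_add]
    apply Real.exp_le_exp.2
    nlinarith
  calc t ^ (C - 1) * (1 + t) ^ q * Real.exp (-((1 + t) * x))
      ≤ t ^ (C - 1) * (N.factorial / (x/2)^N * Real.exp ((1 + t) * (x/2)))
          * Real.exp (-((1 + t) * x)) := by
        gcongr
        exact h1.trans h3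
    _ = N.factorial / (x/2)^N * (t ^ (C - 1) *
          (Real.exp ((1 + t) * (x/2)) * Real.exp (-((1 + t) * x)))) := by ring
    _ ≤ _ := by gcongr

lemma H_deriv {C : ℝ} (hC : 0 < C) (q : ℝ) {x : ℝ} (hx : 0 < x) :
    HasDerivAt (H C q) (-(H C (q + 1) x)) x := by
  have key := hasDerivAt_integral_of_dominated_loc_of_deriv_le
    (μ := volume.restrict (Ioi (0:ℝ)))
    (F := fun x t : ℝ => t ^ (C - 1) * (1 + t) ^ q * Real.exp (-((1 + t) * x)))
    (F' := fun x t : ℝ => -(t ^ (C - 1) * (1 + t) ^ (q+1) * Real.exp (-((1 + t) * x))))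
    (x₀ := x) (s := Metric.ball x (x/2))
    (bound := fun t : ℝ => t ^ (C - 1) * (1 + t) ^ (q+1) * Real.exp (-((1 + t) * (x/2))))
    (Metric.ball_mem_nhds x (by positivity))
    (Eventually.of_forall fun y => (contOn C q y).aestronglyMeasurable measurableSet_Ioi)
    (H_integrable hC q hx)
    ((contOn C (q+1) x).aestronglyMeasurable measurableSet_Ioi).neg
    ?_ (H_integrable hC (q+1) (by positivity)) ?_
  · have := key.2
    rw [integral_neg] at this
    exact this
  · refine (ae_restrict_iff' measurableSet_Ioi).2 (Eventually.of_forall fun t ht y hy => ?_)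
    have ht : (0:ℝ) < t := ht
    rw [norm_neg, Real.norm_of_nonneg (by positivity)]
    have hy' : x / 2 ≤ y := by
      rw [Metric.mem_ball, Real.dist_eq, abs_lt] at hy
      linarith
    gcongr
  · refine (ae_restrict_iff' measurableSet_Ioi).2 (Eventually.of_forall fun t ht y hy => ?_)
    have ht : (0:ℝ) < t := ht
    have h1 : HasDerivAt (fun y : ℝ => -((1 + t) * y)) (-((1 + t) * 1)) y :=
      ((hasDerivAt_id y).const_mul (1 + t)).neg
    have h2 := (h1.exp).const_mul (t ^ (C - 1) * (1 + t) ^ q)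
    refine h2.congr_deriv ?_
    rw [Real.rpow_add_one (by positivity)]
    ring

/-- `I C s = ∫ t^(C-1) (1+t)^s dt`. -/
noncomputable def I (C s : ℝ) : ℝ := ∫ t in Set.Ioi (0:ℝ), t ^ (C - 1) * (1 + t) ^ s

lemma I_integrable {C s : ℝ} (hC : 0 < C) (hs : s + C < 0) :
    IntegrableOn (fun t : ℝ => t ^ (C - 1) * (1 + t) ^ s) (Ioi 0) := by
  have hc : ContinuousOn (fun t : ℝ => t ^ (C - 1) * (1 + t) ^ s) (Ioi 0) := by
    refine ContinuousOn.mul ?_ ?_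
    · exact continuousOn_id.rpow_const (fun t ht => Or.inl (ne_of_gt ht))
    · refine ContinuousOn.rpow_const (by fun_prop) (fun t ht => Or.inl ?_)
      have : (0:ℝ) < t := ht
      positivity
  rw [← Ioc_union_Ioi_eq_Ioi (zero_le_one (α := ℝ))]
  refine IntegrableOn.union ?_ ?_
  · have h0 : IntegrableOn (fun t : ℝ => t ^ (C - 1)) (Ioc 0 1) :=
      (intervalIntegrable_iff_integrableOn_Ioc_of_le zero_le_one).1
        (intervalIntegral.intervalIntegrable_rpow' (by linarith))
    refine Integrable.mono' h0
      ((hc.mono Ioc_subset_Ioi_self).aestronglyMeasurable measurableSet_Ioc) ?_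
    refine (ae_restrict_iff' measurableSet_Ioc).2 (Eventually.of_forall fun t ht => ?_)
    have ht : (0:ℝ) < t := ht.1
    rw [Real.norm_of_nonneg (by positivity)]
    have := Real.rpow_le_one_of_one_le_of_nonpos (x := 1 + t) (z := s) (by linarith) (by linarith)
    exact mul_le_of_le_one_right (by positivity) this
  · have h0 : IntegrableOn (fun t : ℝ => t ^ (C - 1 + s)) (Ioi 1) :=
      integrableOn_Ioi_rpow_of_lt (by linarith) one_pos
    refine Integrable.mono' h0
      ((hc.mono (Ioi_subset_Ioi zero_le_one)).aestronglyMeasurable measurableSet_Ioi) ?_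
    refine (ae_restrict_iff' measurableSet_Ioi).2 (Eventually.of_forall fun t ht => ?_)
    have ht : (0:ℝ) < t := lt_trans one_pos ht
    rw [Real.norm_of_nonneg (by positivity), Real.rpow_add ht]
    have := Real.rpow_le_rpow_of_nonpos (x := t) (y := 1 + t) (z := s) ht (by linarith)
      (by linarith)
    gcongr

lemma inner {C p q : ℝ} (hp : -1 < p) {t : ℝ} (ht : 0 < t) :
    ∫ x in Ioi (0:ℝ), x ^ p * (t ^ (C - 1) * (1 + t) ^ q * Real.exp (-((1 + t) * x)))
      = Real.Gamma (p + 1) * (t ^ (C - 1) * (1 + t) ^ (q - p - 1)) := by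
  have h := Real.integral_rpow_mul_exp_neg_mul_Ioi (a := p + 1) (r := 1 + t)
    (by linarith) (by linarith)
  rw [show (fun x : ℝ => x ^ p * (t ^ (C - 1) * (1 + t) ^ q * Real.exp (-((1 + t) * x))))
    = fun x : ℝ => (t ^ (C - 1) * (1 + t) ^ q) * (x ^ (p + 1 - 1) * Real.exp (-((1 + t) * x)))
    from by funext x; rw [add_sub_cancel_right]; ring, integral_const_mul, h]
  rw [show q - p - 1 = q + -(p+1) by ring, Real.rpow_add (by positivity : (0:ℝ) < 1 + t),
    Real.rpow_neg (by positivity), one_div, Real.inv_rpow (by positivity)]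
  ring

lemma prod_integrable {C p q : ℝ} (hC : 0 < C) (hp : -1 < p) (hs : q - p - 1 + C < 0) :
    Integrable (Function.uncurry fun x t : ℝ =>
      x ^ p * (t ^ (C - 1) * (1 + t) ^ q * Real.exp (-((1 + t) * x))))
      ((volume.restrict (Ioi (0:ℝ))).prod (volume.restrict (Ioi (0:ℝ)))) := by
  have hm : Measurable (Function.uncurry fun x t : ℝ =>
      x ^ p * (t ^ (C - 1) * (1 + t) ^ q * Real.exp (-((1 + t) * x)))) := by
    unfold Function.uncurry
    fun_prop
  rw [integrable_prod_iff' hm.aestronglyMeasurable]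
  constructor
  · refine (ae_restrict_iff' measurableSet_Ioi).2 (Eventually.of_forall fun t ht => ?_)
    have ht : (0:ℝ) < t := ht
    have h := integrableOn_rpow_mul_exp_neg_mul_rpow (s := p) (p := 1) (b := 1 + t) hp
      (by norm_num) (by linarith)
    refine (h.const_mul (t ^ (C - 1) * (1 + t) ^ q)).congr (Eventually.of_forall fun x => ?_)
    simp only [Function.uncurry, Real.rpow_one, neg_mul]
    ring
  · refine ((I_integrable hC hs).const_mul (Real.Gamma (p + 1))).congr ?_
    refine (ae_restrict_iff' measurableSet_Ioi).2 (Eventually.of_forall fun t ht => ?_)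
    have ht : (0:ℝ) < t := ht
    try simp only
    rw [← inner hp ht]
    refine setIntegral_congr_fun measurableSet_Ioi fun x hx => ?_
    have hx : (0:ℝ) < x := hx
    simp only [Function.uncurry]
    rw [Real.norm_of_nonneg (by positivity)]

lemma G_integrable {C p q : ℝ} (hC : 0 < C) (hp : -1 < p) (hs : q - p - 1 + C < 0) :
    IntegrableOn (fun x : ℝ => x ^ p * H C q x) (Ioi 0) := by
  have h := (prod_integrable hC hp hs).integral_prod_left
  refine h.congr (Eventually.of_forall fun x => ?_)
  simp only [Function.uncurry, H, integral_const_mul]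

lemma G_integral {C p q : ℝ} (hC : 0 < C) (hp : -1 < p) (hs : q - p - 1 + C < 0) :
    ∫ x in Ioi (0:ℝ), x ^ p * H C q x = Real.Gamma (p + 1) * I C (q - p - 1) := by
  have h := integral_integral_swap (prod_integrable hC hp hs)
  simp only [integral_const_mul] at h
  unfold H
  rw [h, I, ← integral_const_mul]
  exact setIntegral_congr_fun measurableSet_Ioi fun t ht => inner hp ht

lemma beta {C B : ℝ} (hC : 0 < C) (hB : -1 < B) :
    Real.Gamma (C + B + 1) * I C (-C - B - 1) = Real.Gamma C * Real.Gamma (B + 1) := by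
  have h := G_integral (C := C) (p := C + B) (q := 0) hC (by linarith) (by linarith)
  rw [show 0 - (C + B) - 1 = -C - B - 1 by ring] at h
  rw [← h, Real.Gamma_eq_integral (by linarith : 0 < B + 1), ← integral_const_mul]
  refine setIntegral_congr_fun measurableSet_Ioi fun x hx => ?_
  have hx : (0:ℝ) < x := hx
  have h2 := Real.integral_rpow_mul_exp_neg_mul_Ioi hC hx
  have h3 : H C 0 x = Real.exp (-x) * ((1 / x) ^ C * Real.Gamma C) := by
    rw [← h2, H, ← integral_const_mul]
    congr 1
    funext t
    rw [Real.rpow_zero, show -((1 + t) * x) = -x + -(x * t) by ring, Real.exp_add]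
    ring
  try simp only
  rw [h3, Real.rpow_add hx, one_div, Real.inv_rpow hx.le, add_sub_cancel_right]
  have : x ^ C ≠ 0 := by positivity
  field_simp

/-- Finite combinations of `x^(p+i) H C (p+i+δ)`. -/
inductive Good (C p δ : ℝ) : (ℝ → ℝ) → Prop
  | base (k : ℝ) (i : ℕ) : Good C p δ (fun x => k * (x ^ (p + i) * H C (p + i + δ) x))
  | add (f g : ℝ → ℝ) : Good C p δ f → Good C p δ g → Good C p δ (fun x => f x + g x)
  | congr (f g : ℝ → ℝ) : (∀ x, 0 < x → f x = g x) → Good C p δ f → Good C p δ g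

lemma base_deriv {C : ℝ} (hC : 0 < C) (k p q : ℝ) {x : ℝ} (hx : 0 < x) :
    HasDerivAt (fun x => k * (x ^ p * H C q x))
      ((k * p) * (x ^ (p - 1) * H C q x) + (-k) * (x ^ p * H C (q + 1) x)) x := by
  have h := ((Real.hasDerivAt_rpow_const (p := p) (Or.inl hx.ne')).mul
    (H_deriv hC q hx)).const_mul k
  refine h.congr_deriv ?_
  ring

lemma Good.diff {C p δ : ℝ} (hC : 0 < C) {f : ℝ → ℝ} (hf : Good C p δ f) :
    ∀ x, 0 < x → DifferentiableAt ℝ f x := by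
  induction hf with
  | base k i => exact fun x hx => (base_deriv hC k _ _ hx).differentiableAt
  | add f g _ _ ihf ihg => exact fun x hx => (ihf x hx).add (ihg x hx)
  | congr f g h _ ih =>
    intro x hx
    refine (ih x hx).congr_of_eventuallyEq ?_
    filter_upwards [Ioi_mem_nhds hx] with y hy
    exact (h y hy).symm

lemma deriv_congr {f g : ℝ → ℝ} (h : ∀ x, 0 < x → f x = g x) {x : ℝ} (hx : 0 < x) :
    deriv f x = deriv g x := by
  refine EventuallyEq.deriv_eq ?_
  filter_upwards [Ioi_mem_nhds hx] with y hy
  exact h y hy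

lemma Good.deriv {C p δ : ℝ} (hC : 0 < C) {f : ℝ → ℝ} (hf : Good C p δ f) :
    Good C (p - 1) (δ + 1) (deriv f) := by
  induction hf with
  | base k i =>
    refine Good.congr _ _ ?_ (Good.add _ _
      (Good.base (k * (p + i)) i) (Good.base (-k) (i + 1)))
    intro x hx
    rw [(base_deriv hC k _ _ hx).deriv]
    push_cast
    rw [show p - 1 + i = p + i - 1 by ring, show p + i - 1 + (δ + 1) = p + i + δ by ring,
      show p - 1 + (i + 1 : ℝ) = p + i by ring, show p + i + (δ + 1) = p + i + δ + 1 by ring]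
  | add f g hf hg ihf ihg =>
    refine Good.congr _ _ ?_ (Good.add _ _ ihf ihg)
    intro x hx
    exact (deriv_fun_add (hf.diff hC x hx) (hg.diff hC x hx)).symm
  | congr f g h _ ih => exact Good.congr _ _ (fun x hx => deriv_congr h hx) ih

lemma Good.integrable {C p δ : ℝ} (hC : 0 < C) {f : ℝ → ℝ} (hf : Good C p δ f) (j : ℕ)
    (hp : -1 < p + j) (hs : δ - j - 1 + C < 0) :
    IntegrableOn (fun x => x ^ j * f x) (Ioi 0) := by
  induction hf with
  | base k i =>
    have hi : (0:ℝ) ≤ i := i.cast_nonneg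
    have h := (G_integrable (C := C) (p := p + i + j) (q := p + i + δ) hC (by linarith)
      (by linarith)).const_mul k
    refine IntegrableOn.congr_fun h (fun x hx => ?_) measurableSet_Ioi
    try simp only
    rw [Real.rpow_add_natCast (ne_of_gt hx)]
    ring
  | add f g _ _ ihf ihg =>
    refine (ihf.add ihg).congr (Eventually.of_forall fun x => ?_)
    simp only [Pi.add_apply]
    ring
  | congr f g h _ ih =>
    refine IntegrableOn.congr_fun ih (fun x hx => ?_) measurableSet_Ioi
    try simp only
    rw [h x hx]

lemma base_integral {C p q : ℝ} (hC : 0 < C) (k : ℝ) (j : ℕ)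
    (hp : -1 < p + j) (hs : q - p - j - 1 + C < 0) :
    ∫ x in Ioi (0:ℝ), x ^ j * (k * (x ^ p * H C q x))
      = k * (Real.Gamma (p + j + 1) * I C (q - p - j - 1)) := by
  have h := G_integral (C := C) (p := p + j) (q := q) hC hp (by linarith)
  rw [show q - p - j - 1 = q - (p + j) - 1 by ring, ← h, ← integral_const_mul]
  refine setIntegral_congr_fun measurableSet_Ioi fun x hx => ?_
  try simp only
  rw [Real.rpow_add_natCast (ne_of_gt hx)]
  ring

lemma Good.ibp {C p δ : ℝ} (hC : 0 < C) {f : ℝ → ℝ} (hf : Good C p δ f) (j : ℕ)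
    (hp : 0 < p + j) (hs : δ - j + C < 0) :
    ∫ x in Ioi (0:ℝ), x ^ j * _root_.deriv f x
      = -(j * ∫ x in Ioi (0:ℝ), x ^ (j - 1) * f x) := by
  induction hf with
  | base k i =>
    have hi : (0:ℝ) ≤ i := i.cast_nonneg
    have g1 : Good C (p - 1) (δ + 1)
      (fun x => (k * (p + i)) * (x ^ (p - 1 + i) * H C (p - 1 + i + (δ + 1)) x)) := Good.base _ _
    have g2 : Good C (p - 1) (δ + 1)
      (fun x => (-k) * (x ^ (p - 1 + (i + 1 : ℕ)) * H C (p - 1 + (i + 1 : ℕ) + (δ + 1)) x)) :=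
      Good.base _ _
    have i1 := g1.integrable hC j (by linarith) (by linarith)
    have i2 := g2.integrable hC j (by linarith) (by linarith)
    have e : ∫ x in Ioi (0:ℝ),
        x ^ j * _root_.deriv (fun x => k * (x ^ (p + i) * H C (p + i + δ) x)) x
        = (∫ x in Ioi (0:ℝ),
          x ^ j * ((k * (p + i)) * (x ^ (p - 1 + i) * H C (p - 1 + i + (δ + 1)) x))) +
          ∫ x in Ioi (0:ℝ), x ^ j *
            ((-k) * (x ^ (p - 1 + (i + 1 : ℕ)) * H C (p - 1 + (i + 1 : ℕ) + (δ + 1)) x)) := by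
      rw [← integral_add i1 i2]
      refine setIntegral_congr_fun measurableSet_Ioi fun x hx => ?_
      try simp only
      rw [(base_deriv hC k _ _ hx).deriv]
      push_cast
      rw [show p - 1 + i = p + i - 1 by ring, show p + i - 1 + (δ + 1) = p + i + δ by ring,
        show p - 1 + (i + 1 : ℝ) = p + i by ring, show p + i + (δ + 1) = p + i + δ + 1 by ring]
      ring
    rw [e, base_integral hC _ j (by linarith) (by linarith),
      base_integral hC _ j (by push_cast; linarith) (by push_cast; linarith)]
    have e1 : p - 1 + (i:ℝ) + (δ + 1) - (p - 1 + i) - j - 1 = δ - j := by ring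
    have e2 : p - 1 + ((i + 1 : ℕ):ℝ) + (δ + 1) - (p - 1 + ((i + 1 : ℕ):ℝ)) - j - 1 = δ - j := by
      ring
    rw [e1, e2]
    have e3 : p - 1 + (i:ℝ) + j + 1 = p + i + j := by ring
    have e4 : p - 1 + ((i + 1 : ℕ):ℝ) + j + 1 = p + i + j + 1 := by push_cast; ring
    rw [e3, e4, Real.Gamma_add_one (by linarith : p + i + j ≠ 0)]
    rcases j with _ | j
    · push_cast
      ring
    · push_cast at hp hs ⊢
      rw [base_integral hC _ j (by linarith) (by linarith)]
      rw [show p + i + δ - (p + i) - j - 1 = δ - (j + 1) by ring,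
        show p + (i:ℝ) + (j + 1) = p + i + j + 1 by ring]
      ring
  | add f g hf hg ihf ihg =>
    have a1 := (hf.deriv hC).integrable hC j (by linarith) (by linarith)
    have a2 := (hg.deriv hC).integrable hC j (by linarith) (by linarith)
    have e : ∫ x in Ioi (0:ℝ), x ^ j * _root_.deriv (fun x => f x + g x) x
        = (∫ x in Ioi (0:ℝ), x ^ j * _root_.deriv f x)
          + ∫ x in Ioi (0:ℝ), x ^ j * _root_.deriv g x := by
      rw [← integral_add a1 a2]
      refine setIntegral_congr_fun measurableSet_Ioi fun x hx => ?_
      try simp only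
      rw [deriv_fun_add (hf.diff hC x hx) (hg.diff hC x hx)]
      ring
    rw [e, ihf, ihg]
    rcases j with _ | j
    · simp
    · push_cast at hp hs
      have b1 := hf.integrable hC j (by linarith) (by linarith)
      have b2 := hg.integrable hC j (by linarith) (by linarith)
      simp only [Nat.add_sub_cancel, mul_add]
      rw [integral_add b1 b2]
      ring
  | congr f g h _ ih =>
    have e1 : ∫ x in Ioi (0:ℝ), x ^ j * _root_.deriv g x
        = ∫ x in Ioi (0:ℝ), x ^ j * _root_.deriv f x :=
      setIntegral_congr_fun measurableSet_Ioi fun x hx => by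
        try simp only
        rw [deriv_congr h hx]
    have e2 : ∫ x in Ioi (0:ℝ), x ^ (j - 1) * g x
        = ∫ x in Ioi (0:ℝ), x ^ (j - 1) * f x :=
      setIntegral_congr_fun measurableSet_Ioi fun x hx => by
        try simp only
        rw [h x hx]
    rw [e1, e2, ih]

lemma iter_good {C p δ : ℝ} (hC : 0 < C) {f : ℝ → ℝ} (hf : Good C p δ f) (k : ℕ) :
    Good C (p - k) (δ + k) (deriv^[k] f) := by
  induction k with
  | zero => simpa using hf
  | succ k ih =>
    rw [Function.iterate_succ_apply']
    have := ih.deriv hC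
    push_cast
    rwa [show p - (k + 1 : ℝ) = p - k - 1 by ring, show δ + (k + 1 : ℝ) = δ + k + 1 by ring]

lemma iter_integral {C p δ : ℝ} (hC : 0 < C) {f : ℝ → ℝ} (hf : Good C p δ f) (k : ℕ) :
    ∀ j : ℕ, (k:ℝ) < p + 1 → δ + k - 1 + C < 0 →
    ∫ x in Ioi (0:ℝ), x ^ j * deriv^[k] f x
      = (-1) ^ k * (j.descFactorial k) * ∫ x in Ioi (0:ℝ), x ^ (j - k) * f x := by
  induction k with
  | zero => intro j _ _; simp
  | succ k ih =>
    intro j hp hs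
    push_cast at hp hs
    have hj : (0:ℝ) ≤ j := j.cast_nonneg
    rw [Function.iterate_succ_apply',
      (iter_good hC hf k).ibp hC j (by linarith) (by linarith),
      ih (j - 1) (by linarith) (by linarith)]
    rcases j with _ | j
    · simp
    · rw [Nat.add_sub_cancel, Nat.succ_descFactorial_succ, Nat.add_sub_add_right]
      push_cast
      ring

lemma W_eq (A B C x : ℝ) : W A B C x =
    Real.Gamma (C + B + 1) / (Real.Gamma (A + 1) * Real.Gamma (B + 1)) * (1 / Real.Gamma C) *
      (x ^ A * H C (A - B - C) x) := by
  have : H C (A - B - C) x = Real.exp (-x) *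
      ∫ t in Set.Ioi (0:ℝ), t ^ (C - 1) * (1 + t) ^ (A - B + 1 - C - 1) * Real.exp (-t * x) := by
    rw [H, ← integral_const_mul]
    congr 1
    funext t
    rw [show -((1 + t) * x) = -x + -t * x by ring, Real.exp_add,
      show A - B + 1 - C - 1 = A - B - C by ring]
    ring
  rw [this, W, TricomiU]
  ring

lemma W_good (A B C : ℝ) : Good C A (-B - C) (W A B C) := by
  refine Good.congr _ _ ?_ (Good.base
    (Real.Gamma (C + B + 1) / (Real.Gamma (A + 1) * Real.Gamma (B + 1)) * (1 / Real.Gamma C)) 0)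
  intro x _
  rw [W_eq, Nat.cast_zero, add_zero, show A + (-B - C) = A - B - C by ring]

lemma W_integral {A B C : ℝ} (hA : -1 < A) (hB : -1 < B) (hC : 0 < C) :
    ∫ x in Ioi (0:ℝ), W A B C x = 1 := by
  simp only [W_eq]
  rw [integral_const_mul, G_integral hC hA (by linarith),
    show A - B - C - A - 1 = -C - B - 1 by ring]
  have h := beta hC hB
  have h1 := (Real.Gamma_pos_of_pos (by linarith : 0 < A + 1)).ne'
  have h2 := (Real.Gamma_pos_of_pos (by linarith : 0 < B + 1)).ne'
  have h3 := (Real.Gamma_pos_of_pos hC).ne'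
  field_simp
  linarith

end RodAux

theorem rodrigues_typeI (a b c : ℝ) (ha : a > -1) (hb : b > -1)
    (hc : c > max 0 (a - b)) (d : ℕ) (hd : d ≤ 1) (n : ℕ) (hn : 1 ≤ n) :
    (∀ j : ℕ, j + 2 ≤ n →
      ∫ x in Set.Ioi (0:ℝ), x ^ j * QtypeI a b c d n x = 0) ∧
    ∫ x in Set.Ioi (0:ℝ), x ^ (n - 1) * QtypeI a b c d n x = 1 := by
  obtain ⟨m, rfl⟩ : ∃ m, n = m + 1 := ⟨n - 1, by omega⟩
  have hc0 : 0 < c := lt_of_le_of_lt (le_max_left _ _) hc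
  have hm : (0:ℝ) ≤ m := m.cast_nonneg
  have hC : 0 < c + (((m + 1 + d) / 2 : ℕ) : ℝ) := by positivity
  unfold QtypeI
  simp only [Nat.add_sub_cancel]
  have eA : ∀ y : ℝ, y + ((m + 1 : ℕ) : ℝ) - 1 = y + m := by intro y; push_cast; ring
  rw [eA, eA]
  generalize c + (((m + 1 + d) / 2 : ℕ) : ℝ) = C at hC
  have key := fun j => RodAux.iter_integral hC (RodAux.W_good (a + m) (b + m) C) m j
    (by linarith) (by linarith)
  have pull : ∀ j : ℕ, ∫ x in Set.Ioi (0:ℝ), x ^ j * ((-1 : ℝ) ^ m / m.factorial *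
      deriv^[m] (W (a + m) (b + m) C) x) = (-1 : ℝ) ^ m / m.factorial *
      ∫ x in Set.Ioi (0:ℝ), x ^ j * deriv^[m] (W (a + m) (b + m) C) x := by
    intro j
    rw [← integral_const_mul]
    congr 1
    funext x
    ring
  constructor
  · intro j hj
    rw [pull, key, Nat.descFactorial_of_lt (by omega)]
    simp
  · rw [pull, key, Nat.descFactorial_self]
    simp only [Nat.sub_self, pow_zero, one_mul]
    rw [RodAux.W_integral (by linarith) (by linarith) hC]
    have h1 : (m.factorial : ℝ) ≠ 0 := by positivity
    have h2 : ((-1:ℝ) ^ m) * (-1) ^ m = 1 := by rw [← mul_pow]; simp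
    field_simp
    linear_combination h2
end

section
/- Let a > −1, b > −1, c > max{0, a−b} be real numbers and k a nonnegative integer. Then ∫_0^∞ x^k P_{2k+1}^{(0)}(x; a, b, c) W(x; a, b, c+1) dx = − (2k+1)! (a+1)_{2k+1} (b+1)_{2k+1} (c+b−a+1)_k (c+1)_k (c+b+1)_k / ( (c+b+1)_{3k+1} (c+b+2)_{3k+1} ), and ∫_0^∞ x^k P_{2k+1}^{(1)}(x; a, b, c) W(x; a, b, c) dx = (2k+1)! (a+1)_{2k+1} (b+1)_{2k+1} / (c+b+1)_{3k+2}. In particular both integrals are nonzero. -/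
open MeasureTheory Filter Set

/-- The monic type II multiple orthogonal polynomial on the step line:
`P_n^{(d)}(x; a, b, c) = Σ_{j=0}^n (−1)^{n−j} C(n,j)
  ((a+1+j)_{n−j}(b+1+j)_{n−j}/(c+b+1+⌊(n+d)/2⌋+j)_{n−j}) x^j`. -/
noncomputable def Ptype2 (d : ℕ) (a b c : ℝ) (n : ℕ) (x : ℝ) : ℝ :=
  ∑ j ∈ Finset.range (n + 1),
    (-1 : ℝ) ^ (n - j) * (n.choose j : ℝ) *
      (poch (a + 1 + j) (n - j) * poch (b + 1 + j) (n - j) /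
        poch (c + b + 1 + (((n + d) / 2 : ℕ) : ℝ) + j) (n - j)) * x ^ j


lemma gInt {s r : ℝ} (hs : 0 < s) (hr : 0 < r) :
    IntegrableOn (fun x : ℝ => x ^ (s - 1) * Real.exp (-(r * x))) (Ioi 0) := by
  have := integrableOn_rpow_mul_exp_neg_mul_rpow (s := s - 1) (p := 1) (by linarith) one_pos hr
  refine this.congr_fun (fun x _ => ?_) measurableSet_Ioi
  simp

lemma beta_Ioi {c p : ℝ} (hc : 0 < c) (hp : 0 < p) :
    IntegrableOn (fun t : ℝ => t ^ (c - 1) * (1 / (1 + t)) ^ (c + p)) (Ioi 0) ∧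
    ∫ t in Ioi (0:ℝ), t ^ (c - 1) * (1 / (1 + t)) ^ (c + p)
      = Real.Gamma c * Real.Gamma p / Real.Gamma (c + p) := by
  have hG : 0 < Real.Gamma (c + p) := Real.Gamma_pos_of_pos (by linarith)
  set f : ℝ → ℝ → ℝ := fun x t =>
    x ^ (c + p - 1) * Real.exp (-x) * (t ^ (c - 1) * Real.exp (-(x * t))) with hf
  have hx : ∀ x ∈ Ioi (0:ℝ), ∫ t in Ioi (0:ℝ), f x t
      = Real.Gamma c * (x ^ (p - 1) * Real.exp (-(1 * x))) := by
    intro x hx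
    have hx : 0 < x := hx
    simp only [hf]
    rw [integral_const_mul, Real.integral_rpow_mul_exp_neg_mul_Ioi hc hx,
      show c + p - 1 = c + (p - 1) by ring, Real.rpow_add hx, Real.div_rpow zero_le_one hx.le,
      Real.one_rpow, one_mul]
    have : x ^ c ≠ 0 := (Real.rpow_pos_of_pos hx c).ne'
    field_simp
  have ht : ∀ t ∈ Ioi (0:ℝ), ∫ x in Ioi (0:ℝ), f x t
      = Real.Gamma (c + p) * (t ^ (c - 1) * (1 / (1 + t)) ^ (c + p)) := by
    intro t ht
    have ht : 0 < t := ht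
    have : ∀ x, f x t = t ^ (c - 1) * (x ^ (c + p - 1) * Real.exp (-((1 + t) * x))) := by
      intro x
      simp only [hf]
      rw [show -((1 + t) * x) = -x + -(x * t) by ring, Real.exp_add]; ring
    simp_rw [this]
    rw [integral_const_mul,
      Real.integral_rpow_mul_exp_neg_mul_Ioi (by linarith) (by linarith : 0 < 1 + t)]
    ring
  have hI : Integrable (Function.uncurry f)
      ((volume.restrict (Ioi (0:ℝ))).prod (volume.restrict (Ioi (0:ℝ)))) := by
    rw [integrable_prod_iff]
    · constructor
      · refine (ae_restrict_iff' measurableSet_Ioi).2 (Eventually.of_forall fun x hx => ?_)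
        simp only [Function.uncurry, hf]
        exact (gInt hc hx).const_mul _
      · have : IntegrableOn (fun x => Real.Gamma c * (x ^ (p - 1) * Real.exp (-(1 * x))))
          (Ioi 0) := (gInt hp one_pos).const_mul _
        refine IntegrableOn.congr_fun this (fun x hx' => ?_) measurableSet_Ioi
        rw [← hx x hx']
        refine setIntegral_congr_fun measurableSet_Ioi (fun t ht' => ?_)
        have hx0 : 0 < x := hx'
        have ht0 : 0 < t := ht'
        simp only [Function.uncurry, hf]
        rw [Real.norm_of_nonneg (by positivity)]
    · apply Measurable.aestronglyMeasurable
      simp only [hf, Function.uncurry_def]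
      fun_prop
  constructor
  · have h1 : IntegrableOn (fun t => ∫ x in Ioi (0:ℝ), f x t) (Ioi 0) := hI.integral_prod_right
    have h2 := (h1.congr_fun ht measurableSet_Ioi).const_mul (Real.Gamma (c + p))⁻¹
    refine IntegrableOn.congr_fun h2 (fun t _ => ?_) measurableSet_Ioi
    field_simp
  · have h := integral_integral_swap hI
    rw [setIntegral_congr_fun measurableSet_Ioi hx, setIntegral_congr_fun measurableSet_Ioi ht,
      integral_const_mul, integral_const_mul,
      Real.integral_rpow_mul_exp_neg_mul_Ioi hp one_pos] at h
    rw [eq_div_iff hG.ne', mul_comm, ← h]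
    simp

lemma moment_aux {a b c : ℝ} (ha : a > -1) (hb : b > -1) (hc : 0 < c) (m : ℕ) :
    IntegrableOn (fun x => x ^ m * W a b c x) (Ioi 0) ∧
    ∫ x in Ioi (0:ℝ), x ^ m * W a b c x =
      (Real.Gamma (c + b + 1) / (Real.Gamma (a + 1) * Real.Gamma (b + 1))) *
      (Real.Gamma (a + 1 + m) * Real.Gamma (b + 1 + m) / Real.Gamma (c + (b + 1 + m))) := by
  have hm : (0:ℝ) ≤ m := Nat.cast_nonneg m
  have hGc : 0 < Real.Gamma c := Real.Gamma_pos_of_pos hc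
  set K := Real.Gamma (c + b + 1) / (Real.Gamma (a + 1) * Real.Gamma (b + 1)) with hK
  have hp : 0 < b + 1 + m := by linarith
  have hA : 0 < a + 1 + m := by linarith
  obtain ⟨hB1, hB2⟩ := beta_Ioi hc hp
  set f : ℝ → ℝ → ℝ := fun x t => x ^ (a + 1 + m - 1) * Real.exp (-x) *
    (t ^ (c - 1) * (1 + t) ^ (a - b + 1 - c - 1) * Real.exp (-t * x)) with hf
  have hfx : ∀ x t, f x t = t ^ (c - 1) * (1 + t) ^ (a - b + 1 - c - 1) *
      (x ^ (a + 1 + m - 1) * Real.exp (-((1 + t) * x))) := by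
    intro x t
    simp only [hf]
    rw [show -((1 + t) * x) = -x + -t * x by ring, Real.exp_add]; ring
  have ht : ∀ t ∈ Ioi (0:ℝ), ∫ x in Ioi (0:ℝ), f x t
      = Real.Gamma (a + 1 + m) * (t ^ (c - 1) * (1 / (1 + t)) ^ (c + (b + 1 + m))) := by
    intro t ht
    have ht : 0 < t := ht
    have ht1 : 0 < 1 + t := by linarith
    simp_rw [hfx]
    rw [integral_const_mul, Real.integral_rpow_mul_exp_neg_mul_Ioi hA ht1]
    rw [one_div, Real.inv_rpow ht1.le, Real.inv_rpow ht1.le, ← Real.rpow_neg ht1.le,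
      ← Real.rpow_neg ht1.le, show -(c + (b + 1 + (m:ℝ))) = (a - b + 1 - c - 1) + -(a + 1 + m) by ring,
      Real.rpow_add ht1]
    ring
  have hI : Integrable (Function.uncurry f)
      ((volume.restrict (Ioi (0:ℝ))).prod (volume.restrict (Ioi (0:ℝ)))) := by
    rw [integrable_prod_iff']
    · constructor
      · refine (ae_restrict_iff' measurableSet_Ioi).2 (Eventually.of_forall fun t ht => ?_)
        have ht : 0 < t := ht
        simp only [Function.uncurry, hfx]
        exact (gInt hA (by linarith)).const_mul _
      · refine IntegrableOn.congr_fun (hB1.const_mul (Real.Gamma (a + 1 + m)))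
          (fun t ht' => ?_) measurableSet_Ioi
        rw [← ht t ht']
        refine setIntegral_congr_fun measurableSet_Ioi (fun x hx' => ?_)
        have hx0 : 0 < x := hx'
        have ht0 : 0 < t := ht'
        simp only [Function.uncurry, hf]
        rw [Real.norm_of_nonneg (by positivity)]
    · apply Measurable.aestronglyMeasurable
      simp only [hf, Function.uncurry_def]
      fun_prop
  have hW : ∀ x ∈ Ioi (0:ℝ), K / Real.Gamma c * (∫ t in Ioi (0:ℝ), f x t) = x ^ m * W a b c x := by
    intro x hx
    have hx : 0 < x := hx
    simp only [hf]
    rw [integral_const_mul, W, TricomiU, ← hK, show a + 1 + (m:ℝ) - 1 = a + m by ring,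
      Real.rpow_add hx, Real.rpow_natCast]
    ring
  constructor
  · have h1 : IntegrableOn (fun x => ∫ t in Ioi (0:ℝ), f x t) (Ioi 0) := hI.integral_prod_left
    exact IntegrableOn.congr_fun (h1.const_mul (K / Real.Gamma c)) hW measurableSet_Ioi
  · rw [← setIntegral_congr_fun measurableSet_Ioi hW, integral_const_mul,
      integral_integral_swap hI, setIntegral_congr_fun measurableSet_Ioi ht,
      integral_const_mul, hB2]
    field_simp

lemma poch_succ (z : ℝ) (k : ℕ) : poch z (k + 1) = poch z k * (z + k) := by
  simp [poch, Finset.prod_range_succ]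

lemma poch_add (z : ℝ) (i j : ℕ) : poch z (i + j) = poch z i * poch (z + i) j := by
  simp only [poch, Finset.prod_range_add]
  congr 1
  refine Finset.prod_congr rfl fun x _ => ?_
  push_cast; ring

lemma poch_pos {z : ℝ} (hz : 0 < z) (k : ℕ) : 0 < poch z k :=
  Finset.prod_pos fun i _ => by positivity

lemma Gamma_poch {z : ℝ} (hz : 0 < z) (k : ℕ) :
    Real.Gamma (z + k) = poch z k * Real.Gamma z := by
  induction k with
  | zero => simp [poch]
  | succ k ih =>
    rw [Nat.cast_succ, ← add_assoc, Real.Gamma_add_one (by positivity), ih, poch_succ]; ring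

lemma moment {a b c : ℝ} (ha : a > -1) (hb : b > -1) (hc : 0 < c) (m : ℕ) :
    ∫ x in Ioi (0:ℝ), x ^ m * W a b c x =
      poch (a + 1) m * poch (b + 1) m / poch (c + b + 1) m := by
  have h1 : 0 < a + 1 := by linarith
  have h2 : 0 < b + 1 := by linarith
  have h3 : 0 < c + b + 1 := by linarith
  rw [(moment_aux ha hb hc m).2, Gamma_poch h1, Gamma_poch h2,
    show c + (b + 1 + (m:ℝ)) = c + b + 1 + m by ring, Gamma_poch h3]
  have := Real.Gamma_pos_of_pos h1
  have := Real.Gamma_pos_of_pos h2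
  have := Real.Gamma_pos_of_pos h3
  have := poch_pos h3 m
  field_simp

/-- Sum form of the integral. -/
lemma int_sum {a b c c' : ℝ} (ha : a > -1) (hb : b > -1) (hc' : 0 < c') (d k n : ℕ) :
    ∫ x in Ioi (0:ℝ), x ^ k * Ptype2 d a b c n x * W a b c' x =
      poch (a + 1) n * poch (b + 1) n *
      ∑ j ∈ Finset.range (n + 1), (-1 : ℝ) ^ (n - j) * (n.choose j : ℝ) *
        (poch (a + 1 + j) k * poch (b + 1 + j) k /
        (poch (c + b + 1 + (((n + d) / 2 : ℕ) : ℝ) + j) (n - j) * poch (c' + b + 1) (j + k))) := by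
  have : ∀ x, x ^ k * Ptype2 d a b c n x * W a b c' x =
      ∑ j ∈ Finset.range (n + 1), ((-1 : ℝ) ^ (n - j) * (n.choose j : ℝ) *
      (poch (a + 1 + j) (n - j) * poch (b + 1 + j) (n - j) /
        poch (c + b + 1 + (((n + d) / 2 : ℕ) : ℝ) + j) (n - j))) * (x ^ (j + k) * W a b c' x) := by
    intro x
    rw [Ptype2, Finset.mul_sum, Finset.sum_mul]
    refine Finset.sum_congr rfl fun j _ => ?_
    rw [pow_add]; ring
  simp_rw [this]
  rw [integral_finsetSum _ fun j _ => (moment_aux ha hb hc' (j + k)).1.const_mul _, Finset.mul_sum]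
  refine Finset.sum_congr rfl fun j hj => ?_
  have hj : j ≤ n := by simpa [Nat.lt_succ_iff] using hj
  rw [integral_const_mul, moment ha hb hc', poch_add (a + 1), poch_add (b + 1)]
  have e : ∀ z, poch z n = poch z j * poch (z + j) (n - j) := fun z => by
    rw [← poch_add, Nat.add_sub_cancel' hj]
  rw [e (a + 1), e (b + 1)]
  simp only [div_eq_mul_inv, mul_inv]
  ring

lemma inv_diff (n : ℕ) {y : ℝ} (hy : 0 < y) :
    (fwdDiff (1:ℝ))^[n] (fun x : ℝ => 1 / x) y = (-1) ^ n * n.factorial / poch y (n + 1) := by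
  induction n generalizing y with
  | zero => simp [poch]
  | succ n ih =>
    rw [Function.iterate_succ_apply', fwdDiff, ih hy, ih (by linarith : 0 < y + 1)]
    have p1 := poch_pos (by linarith : 0 < y + 1) n
    have e1 : poch y (n + 1) = y * poch (y + 1) n := by
      rw [add_comm, poch_add]; simp [poch]
    have e2 := poch_succ y (n + 1)
    have e3 := poch_succ (y + 1) n
    rw [e2, e3, e1, Nat.factorial_succ]
    push_cast
    have : y + 1 + n ≠ 0 := by positivity
    have : y + (n + 1) ≠ 0 := by positivity
    field_simp
    ring

lemma inv_sum (n : ℕ) {y : ℝ} (hy : 0 < y) :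
    ∑ j ∈ Finset.range (n + 1), (-1 : ℝ) ^ (n - j) * (n.choose j : ℝ) * (1 / (y + j))
      = (-1) ^ n * n.factorial / poch y (n + 1) := by
  rw [← inv_diff n hy, fwdDiff_iter_eq_sum_shift]
  refine Finset.sum_congr rfl fun j _ => ?_
  simp

open Polynomial in
lemma poly_sum (n : ℕ) (P : ℝ[X]) (hP : P.natDegree < n) :
    ∑ j ∈ Finset.range (n + 1), (-1 : ℝ) ^ (n - j) * (n.choose j : ℝ) * P.eval (j : ℝ) = 0 := by
  have := congrFun (Polynomial.fwdDiff_iter_eq_zero_of_degree_lt hP) 0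
  rw [fwdDiff_iter_eq_sum_shift] at this
  rw [Pi.zero_apply] at this
  rw [← this]
  refine Finset.sum_congr rfl fun j _ => ?_
  simp

open Polynomial in
lemma poly_sum_monic (n : ℕ) (P : ℝ[X]) (hP : P.natDegree = n) (hM : P.Monic) :
    ∑ j ∈ Finset.range (n + 1), (-1 : ℝ) ^ (n - j) * (n.choose j : ℝ) * P.eval (j : ℝ)
      = n.factorial := by
  have := congrFun P.fwdDiff_iter_degree_eq_factorial 0
  rw [fwdDiff_iter_eq_sum_shift, hP, hM.leadingCoeff, one_smul] at this
  rw [Pi.natCast_apply] at this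
  rw [← this]
  refine Finset.sum_congr rfl fun j _ => ?_
  simp

open Polynomial in
lemma poch_poly (z : ℝ) (k : ℕ) : ∃ P : ℝ[X], P.Monic ∧ P.natDegree = k ∧
    ∀ x : ℝ, P.eval x = poch (z + x) k := by
  refine ⟨∏ i ∈ Finset.range k, (X + C (z + i)), ?_, ?_, ?_⟩
  · exact monic_prod_of_monic _ _ fun i _ => monic_X_add_C _
  · rw [natDegree_prod_of_monic _ _ fun i _ => monic_X_add_C _]
    simp only [natDegree_X_add_C, Finset.sum_const, Finset.card_range, smul_eq_mul, mul_one]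
  · intro x
    rw [eval_prod, poch]
    refine Finset.prod_congr rfl fun i _ => ?_
    simp; ring

lemma poch_reflect (z : ℝ) (k : ℕ) : poch (1 - z - k) k = (-1) ^ k * poch z k := by
  rw [poch, poch, ← Finset.prod_range_reflect, ← Finset.card_range k, ← Finset.prod_const,
    Finset.card_range, ← Finset.prod_mul_distrib]
  refine Finset.prod_congr rfl fun i hi => ?_
  have hi : i + 1 ≤ k := Finset.mem_range.1 hi
  rw [Nat.sub_sub, add_comm 1 i, Nat.cast_sub hi]
  push_cast; ring

open Polynomial in
lemma second {a b c : ℝ} (ha : a > -1) (hb : b > -1) (hc : 0 < c) (k : ℕ) :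
    ∫ x in Set.Ioi (0:ℝ), x ^ k * Ptype2 1 a b c (2 * k + 1) x * W a b c x
      = (2 * k + 1).factorial * poch (a + 1) (2 * k + 1) * poch (b + 1) (2 * k + 1) /
          poch (c + b + 1) (3 * k + 2) := by
  have he : 0 < c + b + 1 := by linarith
  rw [int_sum ha hb hc]
  obtain ⟨P, hP1, hP2, hP3⟩ := poch_poly (a + 1) k
  obtain ⟨Q, hQ1, hQ2, hQ3⟩ := poch_poly (b + 1) k
  have hL : (X + C (c + b + 1 + k)).Monic := monic_X_add_C _
  have hs := poly_sum_monic (2 * k + 1) (P * Q * (X + C (c + b + 1 + k)))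
    (by rw [(hP1.mul hQ1).natDegree_mul hL, hP1.natDegree_mul hQ1, hP2, hQ2, natDegree_X_add_C]; ring)
    ((hP1.mul hQ1).mul hL)
  rw [← hs, div_eq_mul_inv, Finset.sum_mul, Finset.sum_mul, Finset.sum_mul, Finset.mul_sum]
  refine Finset.sum_congr rfl fun j hj => ?_
  have hj : j ≤ 2 * k + 1 := by simpa [Nat.lt_succ_iff] using hj
  have e0 : poch (c + b + 1) (3 * k + 2) = poch (c + b + 1) (j + k) * (c + b + 1 + k + j) *
      poch (c + b + 1 + ((k + 1 : ℕ) : ℝ) + j) (2 * k + 1 - j) := by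
    rw [show 3 * k + 2 = (j + k + 1) + (2 * k + 1 - j) by omega, poch_add, poch_succ]
    push_cast
    congr 2 <;> ring
  rw [show (2 * k + 1 + 1) / 2 = k + 1 by omega, e0]
  simp only [eval_mul, hP3, hQ3, eval_add, eval_X, eval_C]
  have : 0 < c + b + 1 + k + j := by positivity
  have := poch_pos he (j + k)
  have : 0 < poch (c + b + 1 + ((k + 1 : ℕ) : ℝ) + j) (2 * k + 1 - j) := poch_pos (by positivity) _
  field_simp
  ring

open Polynomial in
lemma first {a b c : ℝ} (ha : a > -1) (hb : b > -1) (hc : 0 < c) (k : ℕ) :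
    ∫ x in Set.Ioi (0:ℝ), x ^ k * Ptype2 0 a b c (2 * k + 1) x * W a b (c + 1) x
      = -((2 * k + 1).factorial * poch (a + 1) (2 * k + 1) * poch (b + 1) (2 * k + 1) *
          poch (c + b - a + 1) k * poch (c + 1) k * poch (c + b + 1) k /
          (poch (c + b + 1) (3 * k + 1) * poch (c + b + 2) (3 * k + 1))) := by
  have he : 0 < c + b + 1 := by linarith
  have hy : 0 < c + b + 1 + k := by positivity
  rw [int_sum ha hb (by linarith)]
  obtain ⟨P, hP1, hP2, hP3⟩ := poch_poly (a + 1) k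
  obtain ⟨Q, hQ1, hQ2, hQ3⟩ := poch_poly (b + 1) k
  set y := c + b + 1 + k with hyd
  have hdiv := X_sub_C_mul_divByMonic_eq_sub_modByMonic (P * Q) (-y)
  have hev : ∀ x : ℝ, poch (a + 1 + x) k * poch (b + 1 + x) k =
      (x + y) * ((P * Q) /ₘ (X - C (-y))).eval x + poch (c + b - a + 1) k * poch (c + 1) k := by
    intro x
    have h := congrArg (eval x) hdiv
    rw [modByMonic_X_sub_C_eq_C_eval] at h
    simp only [eval_mul, eval_sub, eval_X, eval_C, hP3, hQ3] at h
    rw [show a + 1 + -y = 1 - (c + b - a + 1) - k by rw [hyd]; ring,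
      show b + 1 + -y = 1 - (c + 1) - k by rw [hyd]; ring, poch_reflect, poch_reflect] at h
    have h1 : ((-1 : ℝ) ^ k) * (-1) ^ k = 1 := by rw [← mul_pow]; simp
    linear_combination -h + poch (c + b - a + 1) k * poch (c + 1) k * h1
  have hs1 := poly_sum (2 * k + 1) ((P * Q) /ₘ (X - C (-y))) (by
    have := natDegree_divByMonic (P * Q) (monic_X_sub_C (-y))
    rw [hP1.natDegree_mul hQ1, hP2, hQ2] at this
    omega)
  have hs2 := inv_sum (2 * k + 1) hy
  have hp1 := poch_pos he (3 * k + 1)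
  have key : ∑ j ∈ Finset.range (2 * k + 1 + 1), (-1 : ℝ) ^ (2 * k + 1 - j) * ((2 * k + 1).choose j : ℝ) *
        (poch (a + 1 + j) k * poch (b + 1 + j) k /
        (poch (c + b + 1 + (((2 * k + 1 + 0) / 2 : ℕ) : ℝ) + j) (2 * k + 1 - j)
          * poch (c + 1 + b + 1) (j + k))) =
      (c + b + 1) / poch (c + b + 1) (3 * k + 1) *
      (0 + poch (c + b - a + 1) k * poch (c + 1) k *
        ((-1) ^ (2 * k + 1) * (2 * k + 1).factorial / poch y (2 * k + 1 + 1))) := by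
    rw [← hs1, ← hs2, Finset.mul_sum, ← Finset.sum_add_distrib, Finset.mul_sum]
    refine Finset.sum_congr rfl fun j hj => ?_
    have hj : j ≤ 2 * k + 1 := by simpa [Nat.lt_succ_iff] using hj
    have e0 : poch (c + b + 1) (3 * k + 1) = poch (c + b + 1) (j + k) *
        poch (c + b + 1 + (k : ℝ) + j) (2 * k + 1 - j) := by
      rw [show 3 * k + 1 = (j + k) + (2 * k + 1 - j) by omega, poch_add]
      push_cast
      congr 2; ring
    have e1 : poch (c + b + 1) (j + k) * (y + j) = (c + b + 1) * poch (c + 1 + b + 1) (j + k) := by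
      have h1 := poch_succ (c + b + 1) (j + k)
      rw [add_comm (j + k) 1, poch_add] at h1
      simp only [poch, Finset.prod_range_one] at h1 ⊢
      push_cast at h1
      rw [show c + b + 1 + 1 = c + 1 + b + 1 by ring] at h1
      rw [hyd]
      linear_combination -h1
    rw [show (2 * k + 1 + 0) / 2 = k by omega, e0, hev]
    have h1 : 0 < y + j := by positivity
    have h2 := poch_pos he (j + k)
    have h3 : 0 < poch (c + b + 1 + (k : ℝ) + j) (2 * k + 1 - j) := poch_pos (by positivity) _
    have h4 : 0 < poch (c + 1 + b + 1) (j + k) := poch_pos (by linarith) _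
    have e2 : (c + b + 1) / poch (c + b + 1) (j + k) = (y + j) / poch (c + 1 + b + 1) (j + k) := by
      rw [div_eq_div_iff h2.ne' h4.ne']; linear_combination -e1
    rw [div_mul_eq_div_div (c + b + 1), e2]
    field_simp
    ring
  rw [key]
  have e3 : poch (c + b + 1) k * poch y (2 * k + 1 + 1) = (c + b + 1) * poch (c + b + 2) (3 * k + 1) := by
    rw [hyd, ← poch_add, show k + (2 * k + 1 + 1) = 1 + (3 * k + 1) by ring, poch_add]
    simp only [poch, Finset.prod_range_one]
    norm_num
    left
    refine Finset.prod_congr rfl fun i _ => ?_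
    ring
  have h5 := poch_pos hy (2 * k + 1 + 1)
  have h6 : 0 < poch (c + b + 2) (3 * k + 1) := poch_pos (by linarith) _
  have e4 : (c + b + 1) / poch y (2 * k + 1 + 1) = poch (c + b + 1) k / poch (c + b + 2) (3 * k + 1) := by
    rw [div_eq_div_iff h5.ne' h6.ne']; linear_combination -e3
  rw [pow_succ, pow_mul]
  simp only [neg_one_sq, one_pow, one_mul, zero_add]
  rw [show ∀ A B D E F : ℝ, (c + b + 1) / A * (B * (-1 * D / poch y (2 * k + 1 + 1)))
    = -(B * D / A) * ((c + b + 1) / poch y (2 * k + 1 + 1)) from fun _ _ _ _ _ => by ring] <;> try exact 0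
  rw [e4]
  field_simp

theorem normalization_odd (a b c : ℝ) (ha : a > -1) (hb : b > -1)
    (hc : c > max 0 (a - b)) (k : ℕ) :
    (∫ x in Set.Ioi (0:ℝ), x ^ k * Ptype2 0 a b c (2 * k + 1) x * W a b (c + 1) x
      = -((2 * k + 1).factorial * poch (a + 1) (2 * k + 1) * poch (b + 1) (2 * k + 1) *
          poch (c + b - a + 1) k * poch (c + 1) k * poch (c + b + 1) k /
          (poch (c + b + 1) (3 * k + 1) * poch (c + b + 2) (3 * k + 1)))) ∧
    (∫ x in Set.Ioi (0:ℝ), x ^ k * Ptype2 1 a b c (2 * k + 1) x * W a b c x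
      = (2 * k + 1).factorial * poch (a + 1) (2 * k + 1) * poch (b + 1) (2 * k + 1) /
          poch (c + b + 1) (3 * k + 2)) ∧
    (∫ x in Set.Ioi (0:ℝ), x ^ k * Ptype2 0 a b c (2 * k + 1) x * W a b (c + 1) x) ≠ 0 ∧
    (∫ x in Set.Ioi (0:ℝ), x ^ k * Ptype2 1 a b c (2 * k + 1) x * W a b c x) ≠ 0 := by
  have hc0 : 0 < c := lt_of_le_of_lt (le_max_left _ _) hc
  have hc1 : a - b < c := lt_of_le_of_lt (le_max_right _ _) hc
  have h1 := first ha hb hc0 k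
  have h2 := second ha hb hc0 k
  have p1 := poch_pos (by linarith : 0 < a + 1) (2 * k + 1)
  have p2 := poch_pos (by linarith : 0 < b + 1) (2 * k + 1)
  have p3 := poch_pos (by linarith : 0 < c + b - a + 1) k
  have p4 := poch_pos (by linarith : 0 < c + 1) k
  have p5 := poch_pos (by linarith : 0 < c + b + 1)
  have p6 := poch_pos (by linarith : 0 < c + b + 2) (3 * k + 1)
  have q1 := p5 k
  have q2 := p5 (3 * k + 1)
  have q3 := p5 (3 * k + 2)
  refine ⟨h1, h2, ?_, ?_⟩
  · rw [h1, neg_ne_zero]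
    positivity
  · rw [h2]
    positivity
end

section
/- Let a > −1, b > −1, c > max{0, a−b} be real numbers and d ∈ {0, 1}. Set α = 52/81, β = 14/9, γ = 8/27, Δ = γ² − α³/27 = 1119104/14348907 > 0, τ = (γ + √Δ)^{1/3} + (γ − √Δ)^{1/3}, and M = (3/2)τ + β + α/(2τ). Then for every ε > 0 there exists N such that for all n ≥ N, every real root x of the polynomial P_n^{(d)}(·; a, b, c) satisfies |x| ≤ (M + ε) n. -/
/-- Real cube root. -/
noncomputable def cbrt (t : ℝ) : ℝ := Real.sign t * |t| ^ ((1 : ℝ) / 3)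

namespace LZB

lemma poch_pos {z : ℝ} (hz : 0 < z) (k : ℕ) : 0 < poch z k := by
  unfold poch
  exact Finset.prod_pos (fun i _ => by positivity)

lemma poch_succ (z : ℝ) (k : ℕ) : poch z (k + 1) = z * poch (z + 1) k := by
  unfold poch
  rw [Finset.prod_range_succ', mul_comm]
  congr 1
  · simp
  · apply Finset.prod_congr rfl
    intro i _
    push_cast
    ring

lemma choose_step (k j : ℕ) :
    ((k : ℝ) + 1 - j) * ((k + 1).choose j : ℝ) = (k + 1) * (k.choose j : ℝ) := by
  rcases lt_trichotomy j (k + 1) with h | h | h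
  · have h1 := Nat.choose_mul_succ_eq k j
    have h2 : ((k.choose j * (k + 1) : ℕ) : ℝ) = (((k + 1).choose j * (k + 1 - j) : ℕ) : ℝ) := by
      rw [h1]
    rw [Nat.cast_mul, Nat.cast_mul, Nat.cast_sub h.le] at h2
    push_cast at h2
    linarith
  · subst h
    simp
  · rw [Nat.choose_eq_zero_of_lt h, Nat.choose_eq_zero_of_lt (by omega : k < j)]
    simp

/-- The binomial transform. -/
noncomputable def F (n : ℕ) (g : ℕ → ℝ) (k : ℕ) : ℝ :=
  ∑ j ∈ Finset.range (n + 1), (k.choose j : ℝ) * g j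

lemma coef (a b : ℝ) (k j : ℕ) :
    (j : ℝ) * (j + a) * (j + b) * ((k + 1).choose j : ℝ) =
      (k + 1) * ((k : ℝ) * (k - 1) * (((k + 1).choose j : ℝ) - 3 * (k.choose j : ℝ)
          + 3 * ((k - 1).choose j : ℝ) - ((k - 2).choose j : ℝ))
        + (a + b + 3) * k * (((k + 1).choose j : ℝ) - 2 * (k.choose j : ℝ)
          + ((k - 1).choose j : ℝ))
        + (a + 1) * (b + 1) * (((k + 1).choose j : ℝ) - (k.choose j : ℝ))) := by
  rcases k with _ | _ | k
  · have h0 := choose_step 0 j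
    push_cast at h0 ⊢
    simp only [zero_add] at h0 ⊢
    rcases j with _ | _ | j
    · simp
    · simp; ring
    · simp [Nat.choose_eq_zero_of_lt]
  · have h0 := choose_step 0 j
    have h1 := choose_step 1 j
    rcases j with _ | _ | _ | j
    · norm_num
    · simp; ring
    · norm_num; ring
    · simp [Nat.choose_eq_zero_of_lt]
  · have h0 := choose_step k j
    have h1 := choose_step (k + 1) j
    have h2 := choose_step (k + 2) j
    push_cast at h0 h1 h2 ⊢
    simp only [show k + 1 + 1 + 1 = k + 3 from rfl, show k + 1 + 1 = k + 2 from rfl,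
      show k + 2 + 1 = k + 3 from rfl,
      show k + 2 - 1 = k + 1 by omega, show k + 2 - 2 = k by omega] at *
    generalize ((k + 3).choose j : ℝ) = c3 at *
    generalize ((k + 2).choose j : ℝ) = c2 at *
    generalize ((k + 1).choose j : ℝ) = c1 at *
    generalize (k.choose j : ℝ) = c0 at *
    generalize (k : ℝ) = K at *
    generalize (j : ℝ) = J at *
    have e1 : J * c3 = (K + 3) * (c3 - c2) := by linarith
    have e2 : J * c2 = (K + 2) * (c2 - c1) := by linarith
    have e3 : J * c1 = (K + 1) * (c1 - c0) := by linarith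
    have f1 : J * (J - 1) * c3 = (K + 3) * (K + 2) * (c3 - 2 * c2 + c1) := by
      linear_combination (J - 1) * e1 + (K + 3) * e1 - (K + 3) * e2
    have f2 : J * (J - 1) * c2 = (K + 2) * (K + 1) * (c2 - 2 * c1 + c0) := by
      linear_combination (J - 1) * e2 + (K + 2) * e2 - (K + 2) * e3
    have g1 : J * (J - 1) * (J - 2) * c3
        = (K + 3) * (K + 2) * (K + 1) * (c3 - 3 * c2 + 3 * c1 - c0) := by
      linear_combination (J - 2) * f1 + (K + 3) * (K + 2) * (e1 - 2 * e2 + e3)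
    linear_combination g1 + (a + b + 3) * f1 + (a + 1) * (b + 1) * e1

lemma coef1 (k j : ℕ) : (j : ℝ) * (k.choose j : ℝ)
    = k * ((k.choose j : ℝ) - ((k - 1).choose j : ℝ)) := by
  rcases k with _ | k
  · rcases j with _ | j <;> simp
  · have h := choose_step k j
    push_cast at h ⊢
    linarith

lemma recF (n : ℕ) (g : ℕ → ℝ) (a b s x : ℝ)
    (hg : ∀ j < n, g (j + 1) * (j + 1 + a) * (j + 1 + b) = -x * (j + s) * g j)
    (k : ℕ) (hk : k < n) :
    (k : ℝ) * (k - 1) * (F n g (k + 1) - 3 * F n g k + 3 * F n g (k - 1) - F n g (k - 2))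
        + (a + b + 3) * k * (F n g (k + 1) - 2 * F n g k + F n g (k - 1))
        + (a + 1) * (b + 1) * (F n g (k + 1) - F n g k)
      = -x * (k * (F n g k - F n g (k - 1)) + s * F n g k) := by
  have hk1 : (0 : ℝ) < (k : ℝ) + 1 := by positivity
  apply mul_left_cancel₀ hk1.ne'
  have hL : ((k : ℝ) + 1) * ((k : ℝ) * (k - 1) * (F n g (k + 1) - 3 * F n g k
        + 3 * F n g (k - 1) - F n g (k - 2))
        + (a + b + 3) * k * (F n g (k + 1) - 2 * F n g k + F n g (k - 1))
        + (a + 1) * (b + 1) * (F n g (k + 1) - F n g k))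
      = ∑ j ∈ Finset.range (n + 1),
        (j : ℝ) * (j + a) * (j + b) * ((k + 1).choose j : ℝ) * g j := by
    simp only [coef]
    simp only [F, Finset.mul_sum, ← Finset.sum_add_distrib, ← Finset.sum_sub_distrib]
    apply Finset.sum_congr rfl
    intro j _
    ring
  have hR : (k * (F n g k - F n g (k - 1)) + s * F n g k)
      = ∑ j ∈ Finset.range (n + 1), (k.choose j : ℝ) * (j + s) * g j := by
    simp only [F, Finset.mul_sum, ← Finset.sum_add_distrib, ← Finset.sum_sub_distrib]
    apply Finset.sum_congr rfl
    intro j _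
    linear_combination (- g j) * coef1 k j
  rw [hL, hR, Finset.sum_range_succ', Finset.sum_range_succ _ n, Nat.choose_eq_zero_of_lt hk]
  simp only [Nat.cast_zero, zero_mul, add_zero, Finset.mul_sum]
  apply Finset.sum_congr rfl
  intro j hj
  have h1 := hg j (Finset.mem_range.mp hj)
  have h2 : ((k : ℝ) + 1) * (k.choose j : ℝ) = ((k + 1).choose (j + 1) : ℝ) * (j + 1) := by
    exact_mod_cast Nat.add_one_mul_choose_eq k j
  push_cast
  linear_combination ((k + 1).choose (j + 1) : ℝ) * (j + 1) * h1 + x * (j + s) * g j * h2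

lemma arith (n k p q s x : ℝ) (hp0 : 0 < p) (hq0 : 0 < q) (hk0 : 0 ≤ k) (hkn : k + 1 ≤ n)
    (hs : (n - 1) / 2 ≤ s) (hx : 3.3 * n ≤ x) (hn : 7 + 16 * p + 8 * q ≤ n) :
    0 ≤ x * (k + s) - 4 * (k * (k - 1)) - 3 * p * k - 2 * q ∧
    0 ≤ x * (2 * k + s) - 8 * (k * (k - 1)) - 4 * p * k - 2 * q := by
  have hN0 : 0 ≤ n := by linarith
  have hxs : 3.3 * n * ((n - 1) / 2) ≤ x * s :=
    mul_le_mul hx hs (by linarith) (by linarith)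
  have hxk : 3.3 * n * k ≤ x * k := mul_le_mul_of_nonneg_right hx hk0
  have hkk2 : k * k ≤ n * k := mul_le_mul_of_nonneg_right (by linarith) hk0
  have hkk3 : n * k ≤ n * n := mul_le_mul_of_nonneg_left (by linarith) hN0
  have hnk : 0 ≤ n * k := mul_nonneg hN0 hk0
  have hpk : p * k ≤ p * n := mul_le_mul_of_nonneg_left (by linarith) hp0.le
  have hpn : 0 ≤ p * n := by positivity
  have hqn : q * 1 ≤ q * n := mul_le_mul_of_nonneg_left (by linarith) hq0.le
  have hnn : (7 + 16 * p + 8 * q) * n ≤ n * n := mul_le_mul_of_nonneg_right hn hN0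
  constructor <;> norm_num at hxs hxk <;> linarith

lemma pos_mono (n : ℕ) (g : ℕ → ℝ) (a b s x : ℝ) (ha : -1 < a) (hb : -1 < b)
    (hg0 : 0 < g 0)
    (hg : ∀ j < n, g (j + 1) * (j + 1 + a) * (j + 1 + b) = -x * (j + s) * g j)
    (hs : ((n : ℝ) - 1) / 2 ≤ s) (hx : 3.3 * (n : ℝ) ≤ x)
    (hn : 7 + 16 * (a + b + 3) + 8 * ((a + 1) * (b + 1)) ≤ (n : ℝ)) :
    0 < (-1 : ℝ) ^ n * F n g n := by
  set u : ℕ → ℝ := fun k => (-1 : ℝ) ^ k * F n g k with hu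
  set p := a + b + 3 with hp
  set q := (a + 1) * (b + 1) with hq
  have hp0 : 0 < p := by linarith
  have hq0 : 0 < q := mul_pos (by linarith) (by linarith)
  have hrec : ∀ k < n, (k : ℝ) * (k - 1) * (u (k + 1) + 3 * u k + 3 * u (k - 1) + u (k - 2))
        + p * k * (u (k + 1) + 2 * u k + u (k - 1)) + q * (u (k + 1) + u k)
      = x * (k * (u k + u (k - 1)) + s * u k) := by
    intro k hk
    have h := recF n g a b s x hg k hk
    rcases k with _ | _ | k
    · simp only [hu]
      push_cast at h ⊢
      norm_num at h ⊢
      linear_combination (-1) * h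
    · simp only [hu]
      push_cast at h ⊢
      norm_num at h ⊢
      linear_combination h
    · simp only [hu, show k + 1 + 1 - 1 = k + 1 by omega, show k + 1 + 1 - 2 = k by omega,
        pow_succ] at h ⊢
      push_cast at h ⊢
      linear_combination (-(-1 : ℝ) ^ k) * h
  have hu0 : 0 < u 0 := by
    simp only [hu, F]
    rw [Finset.sum_range_succ']
    simpa using hg0
  have key : ∀ k ≤ n, 0 < u k ∧ ∀ i ≤ k, u (i - 1) ≤ u i := by
    intro k
    induction k with
    | zero => intro _; exact ⟨hu0, fun i hi => by simp [Nat.le_zero.mp hi]⟩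
    | succ k ih =>
      intro hk
      obtain ⟨hpos, hmono⟩ := ih (by omega)
      have m1 := hmono k le_rfl
      have m2 := hmono (k - 1) (by omega)
      rw [show k - 1 - 1 = k - 2 by omega] at m2
      have hr := hrec k (by omega)
      have hkn : (k : ℝ) + 1 ≤ n := by exact_mod_cast hk
      have hk0 : (0 : ℝ) ≤ k := by positivity
      have hkk : 0 ≤ (k : ℝ) * (k - 1) := by
        rcases k with _ | k
        · simp
        · push_cast; nlinarith [Nat.cast_nonneg (α := ℝ) k]
      have hA : 0 < (k : ℝ) * (k - 1) + p * k + q := by positivity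
      obtain ⟨c1, c2⟩ := arith n k p q s x hp0 hq0 hk0 hkn hs hx hn
      have hmain : 0 ≤ ((k : ℝ) * (k - 1) + p * k + q) * (u (k + 1) - u k) := by
        have e : ((k : ℝ) * (k - 1) + p * k + q) * (u (k + 1) - u k)
            = (x * (k + s) - 4 * (k * (k - 1)) - 3 * p * k - 2 * q) * u k
              + (x * k - 4 * (k * (k - 1)) - p * k) * u (k - 1)
              + k * (k - 1) * (u (k - 1) - u (k - 2)) := by
          linear_combination hr
        rw [e]
        have t3 : 0 ≤ (k : ℝ) * (k - 1) * (u (k - 1) - u (k - 2)) :=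
          mul_nonneg hkk (by linarith)
        have hpos' : 0 < u (k - 1) := by
          have : ∀ i ≤ k, 0 < u i := by
            intro i
            induction i with
            | zero => intro _; exact hu0
            | succ i ihi =>
              intro hi
              have := hmono (i + 1) hi
              simp only [Nat.add_sub_cancel] at this
              linarith [ihi (by omega)]
          exact this _ (by omega)
        rcases le_total 0 (x * k - 4 * ((k : ℝ) * (k - 1)) - p * k) with h | h
        · have := mul_nonneg c1 hpos.le
          have := mul_nonneg h hpos'.le
          linarith
        · have := mul_le_mul_of_nonpos_left m1 h
          have := mul_nonneg c2 hpos.le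
          linarith
      have hfin : u k ≤ u (k + 1) := by
        have := nonneg_of_mul_nonneg_right hmain hA
        linarith
      refine ⟨by linarith, fun i hi => ?_⟩
      rcases Nat.lt_or_ge i (k + 1) with h | h
      · exact hmono i (by omega)
      · have : i = k + 1 := by omega
        subst this
        simpa using hfin
  exact (key n le_rfl).1

lemma cbrt_ge {t r : ℝ} (hr : 0 < r) (h : r ^ 3 ≤ t) : r ≤ cbrt t := by
  have ht : 0 < t := lt_of_lt_of_le (by positivity) h
  unfold cbrt
  rw [Real.sign_of_pos ht, abs_of_pos ht, one_mul]
  calc r = (r ^ 3) ^ ((1 : ℝ) / 3) := by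
        rw [← Real.rpow_natCast, ← Real.rpow_mul hr.le]; norm_num
    _ ≤ t ^ ((1 : ℝ) / 3) := Real.rpow_le_rpow (by positivity) h (by norm_num)

lemma M_ge (τ : ℝ) (h : 1 ≤ τ) :
    3.3 ≤ (3 / 2) * τ + 14 / 9 + (52 / 81) / (2 * τ) := by
  have : (52 / 81) / (2 * τ) = (26 / 81) / τ := by field_simp; norm_num
  rw [this]
  have h0 : 0 < τ := by linarith
  have : (26 / 81 : ℝ) - (26/81) * (τ - 1) ≤ (26 / 81) / τ := by
    rw [le_div_iff₀ h0]; nlinarith [sq_nonneg (τ - 1)]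
  linarith

lemma tau_ge : 1 ≤ cbrt (8 / 27 + Real.sqrt (1119104 / 14348907))
                + cbrt (8 / 27 - Real.sqrt (1119104 / 14348907)) := by
  have s1 : (0.279 : ℝ) ≤ Real.sqrt (1119104 / 14348907) :=
    Real.le_sqrt_of_sq_le (by norm_num)
  have s2 : Real.sqrt (1119104 / 14348907) ≤ 0.28 := by
    rw [Real.sqrt_le_left (by norm_num)]; norm_num
  have := cbrt_ge (t := 8 / 27 + Real.sqrt (1119104 / 14348907)) (r := 0.8)
    (by norm_num) (by norm_num at *; linarith)
  have := cbrt_ge (t := 8 / 27 - Real.sqrt (1119104 / 14348907)) (r := 0.2)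
    (by norm_num) (by norm_num at *; linarith)
  linarith

/-- The coefficients of `Ptype2` up to sign and binomial. -/
noncomputable def G (a b s : ℝ) (n : ℕ) (x : ℝ) (j : ℕ) : ℝ :=
  (-1 : ℝ) ^ j * (poch (a + 1 + j) (n - j) * poch (b + 1 + j) (n - j) /
    poch (s + j) (n - j)) * x ^ j

lemma G_rec (a b s : ℝ) (hs : 0 < s) (n : ℕ) (x : ℝ) (j : ℕ) (hj : j < n) :
    G a b s n x (j + 1) * (j + 1 + a) * (j + 1 + b) = -x * (j + s) * G a b s n x j := by
  unfold G
  obtain ⟨r, rfl⟩ : ∃ r, n = j + 1 + r := ⟨n - (j + 1), by omega⟩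
  rw [show j + 1 + r - (j + 1) = r by omega, show j + 1 + r - j = r + 1 by omega,
    poch_succ, poch_succ, poch_succ]
  push_cast
  have h1 : 0 < s + j := by positivity
  have h2 := poch_pos (show 0 < s + j + 1 by linarith) r
  rw [show a + 1 + ((j : ℝ) + 1) = a + 1 + j + 1 by ring,
    show b + 1 + ((j : ℝ) + 1) = b + 1 + j + 1 by ring,
    show s + ((j : ℝ) + 1) = s + j + 1 by ring]
  field_simp
  ring

lemma P_eq (d : ℕ) (a b c : ℝ) (n : ℕ) (x : ℝ) :
    Ptype2 d a b c n x
      = (-1 : ℝ) ^ n * F n (G a b (c + b + 1 + (((n + d) / 2 : ℕ) : ℝ)) n x) n := by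
  unfold Ptype2 F
  rw [Finset.mul_sum]
  apply Finset.sum_congr rfl
  intro j hj
  have hj' : j ≤ n := by simpa [Nat.lt_succ_iff] using hj
  have : (-1 : ℝ) ^ (n - j) = (-1) ^ n * (-1) ^ j := by
    obtain ⟨r, rfl⟩ := Nat.exists_eq_add_of_le hj'
    rw [Nat.add_sub_cancel_left, pow_add]
    have h : (-1 : ℝ) ^ j * (-1) ^ j = 1 := by rw [← mul_pow]; norm_num
    linear_combination (-(-1 : ℝ) ^ r) * h
  rw [this, G]
  ring

end LZB

theorem largest_zero_bound_Ptype2 (a b c : ℝ) (ha : a > -1) (hb : b > -1)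
    (hc : c > max 0 (a - b)) (d : ℕ) (hd : d ≤ 1) :
    ((8 / 27 : ℝ) ^ 2 - (52 / 81 : ℝ) ^ 3 / 27 = 1119104 / 14348907) ∧
    (0 : ℝ) < 1119104 / 14348907 ∧
    ∀ ε > (0 : ℝ), ∃ N : ℕ, ∀ n ≥ N, ∀ x : ℝ, Ptype2 d a b c n x = 0 →
      |x| ≤ ((3 / 2) * (cbrt (8 / 27 + Real.sqrt (1119104 / 14348907))
                + cbrt (8 / 27 - Real.sqrt (1119104 / 14348907)))
              + 14 / 9
              + (52 / 81) / (2 * (cbrt (8 / 27 + Real.sqrt (1119104 / 14348907))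
                + cbrt (8 / 27 - Real.sqrt (1119104 / 14348907))))
              + ε) * n := by
  refine ⟨by norm_num, by norm_num, ?_⟩
  intro ε hε
  obtain ⟨N, hN⟩ := exists_nat_ge (7 + 16 * (a + b + 3) + 8 * ((a + 1) * (b + 1)))
  refine ⟨N, fun n hn x hx => ?_⟩
  have hM := LZB.M_ge _ LZB.tau_ge
  have hnN : (N : ℝ) ≤ n := by exact_mod_cast hn
  have hn0 : (0 : ℝ) ≤ n := by positivity
  have hc0 : 0 < c := lt_of_le_of_lt (le_max_left _ _) hc
  set m : ℝ := (((n + d) / 2 : ℕ) : ℝ) with hm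
  have hm0 : 0 ≤ m := by positivity
  have hs : 0 < c + b + 1 + m := by linarith
  have hsn : ((n : ℝ) - 1) / 2 ≤ c + b + 1 + m := by
    have h : n ≤ 2 * ((n + d) / 2) + 1 := by omega
    have h' : (n : ℝ) ≤ 2 * m + 1 := by rw [hm]; exact_mod_cast h
    linarith
  have hpoch : ∀ j : ℕ, 0 < poch (a + 1 + j) (n - j) * poch (b + 1 + j) (n - j) /
        poch (c + b + 1 + m + j) (n - j) := by
    intro j
    have hj : (0 : ℝ) ≤ j := by positivity
    exact div_pos (mul_pos (LZB.poch_pos (by linarith) _) (LZB.poch_pos (by linarith) _))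
      (LZB.poch_pos (by linarith) _)
  have hx0 : 0 ≤ x := by
    by_contra hneg
    push Not at hneg
    have hP := LZB.P_eq d a b c n x
    rw [hx] at hP
    have hF : 0 < LZB.F n (LZB.G a b (c + b + 1 + m) n x) n := by
      unfold LZB.F
      apply Finset.sum_pos
      · intro j hj
        have hj' : j ≤ n := by simpa [Nat.lt_succ_iff] using hj
        have h1 : (0 : ℝ) < (n.choose j : ℝ) := by exact_mod_cast Nat.choose_pos hj'
        have h2 : LZB.G a b (c + b + 1 + m) n x j
            = poch (a + 1 + j) (n - j) * poch (b + 1 + j) (n - j) /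
              poch (c + b + 1 + m + j) (n - j) * (-x) ^ j := by
          rw [LZB.G, neg_pow x j]
          ring
        rw [h2]
        exact mul_pos h1 (mul_pos (hpoch j) (pow_pos (by linarith) _))
      · simp
    have : (-1 : ℝ) ^ n * LZB.F n (LZB.G a b (c + b + 1 + m) n x) n ≠ 0 :=
      mul_ne_zero (pow_ne_zero _ (by norm_num)) hF.ne'
    exact this hP.symm
  rw [abs_of_nonneg hx0]
  by_contra hlt
  push Not at hlt
  have hx3 : 3.3 * (n : ℝ) ≤ x := by
    refine le_trans (mul_le_mul_of_nonneg_right ?_ hn0) hlt.le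
    linarith
  have hfin := LZB.pos_mono n (LZB.G a b (c + b + 1 + m) n x) a b (c + b + 1 + m) x ha hb
    (by
      have := hpoch 0
      simpa [LZB.G] using this)
    (fun j hj => LZB.G_rec a b _ hs n x j hj) hsn hx3 (by linarith)
  rw [← LZB.P_eq d a b c n x] at hfin
  linarith
end
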